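/- arXiv:0904.2419 — 7 statements merged into one kernel-verified Lean document; each statement's English description precedes it below -/
import Mathlib

section
/- Let n k : ℕ with k ≤ n. Inside the space Matrix (Fin (2*n)) (Fin (2*n)) ℂ, the closure of the set V_{2k} = {A | Aᵀ = −A ∧ A.rank = 2*k} equals the set {A | Aᵀ = −A ∧ A.rank ≤ 2*k}; equivalently, the closure of V_{2k} is the union of the sets V_{2j} = {A | Aᵀ = −A ∧ A.rank = 2*j} for j = 0, …, k. -/
open Matrix

theorem aux_exists_sub {V : Type*} [AddCommGroup V] [Module ℂ V] [FiniteDimensional ℂ V]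
    (N : Submodule ℂ V) (d : ℕ) (h1 : Module.finrank ℂ N ≤ d) (h2 : d ≤ Module.finrank ℂ V) :
    ∃ W : Submodule ℂ V, N ≤ W ∧ Module.finrank ℂ W = d := by
  obtain ⟨C, hC⟩ := N.exists_isCompl
  have hs := Submodule.finrank_add_eq_of_isCompl hC
  obtain ⟨f, hf⟩ := exists_linearIndependent_of_le_finrank
    (R := ℂ) (M := C) (n := d - Module.finrank ℂ N) (by omega)
  have hf' := hf.map' C.subtype (Submodule.ker_subtype C)
  set C' := Submodule.span ℂ (Set.range (C.subtype ∘ f)) with hC'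
  have hd : Module.finrank ℂ C' = d - Module.finrank ℂ N := by
    rw [hC', finrank_span_eq_card hf', Fintype.card_fin]
  have hle : C' ≤ C := by
    rw [hC', Submodule.span_le]
    rintro _ ⟨i, rfl⟩
    exact (f i).2
  have hdis : N ⊓ C' = ⊥ := (hC.disjoint.mono_right hle).eq_bot
  refine ⟨N ⊔ C', le_sup_left, ?_⟩
  have := Submodule.finrank_sup_add_finrank_inf_eq N C'
  rw [hdis, finrank_bot] at this
  omega

theorem aux_factor {n k : ℕ} (hk : k ≤ n) (A : Matrix (Fin (2 * n)) (Fin (2 * n)) ℂ)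
    (hr : A.rank ≤ 2 * k) :
    ∃ (Q : Matrix (Fin (2 * n)) (Fin k ⊕ Fin k) ℂ) (L : Matrix (Fin k ⊕ Fin k) (Fin (2 * n)) ℂ),
      L * Q = 1 ∧ Q * (L * A) = A := by
  obtain ⟨W, hW, hd⟩ := aux_exists_sub (LinearMap.range A.mulVecLin) (2 * k) hr
    (by simp; omega)
  have e : (Fin k ⊕ Fin k → ℂ) ≃ₗ[ℂ] W := LinearEquiv.ofFinrankEq _ _ (by simp [hd]; omega)
  set q : (Fin k ⊕ Fin k → ℂ) →ₗ[ℂ] (Fin (2 * n) → ℂ) := W.subtype ∘ₗ e.toLinearMap with hq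
  have hqi : LinearMap.ker q = ⊥ := by
    rw [LinearMap.ker_eq_bot]
    exact W.injective_subtype.comp e.injective
  obtain ⟨l, hl⟩ := q.exists_leftInverse_of_injective hqi
  refine ⟨LinearMap.toMatrix' q, LinearMap.toMatrix' l, ?_, ?_⟩
  · rw [← LinearMap.toMatrix'_comp, hl, LinearMap.toMatrix'_id]
  · apply Matrix.toLin'.injective
    rw [Matrix.toLin'_mul, Matrix.toLin'_mul, Matrix.toLin'_toMatrix', Matrix.toLin'_toMatrix']
    apply LinearMap.ext
    intro x
    have hx : A.mulVecLin x ∈ W := hW ⟨x, rfl⟩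
    have h2 : q (e.symm ⟨_, hx⟩) = A.mulVecLin x := by simp [hq]
    have h3 := LinearMap.congr_fun hl (e.symm ⟨_, hx⟩)
    simp only [LinearMap.comp_apply, LinearMap.id_apply] at h3 ⊢
    change q (l (A.mulVecLin x)) = A.mulVecLin x
    rw [← h2, h3]

theorem aux_closed (m d : ℕ) : IsClosed {A : Matrix (Fin m) (Fin m) ℂ | A.rank ≤ d} := by
  have hc : Continuous fun A : Matrix (Fin m) (Fin m) ℂ =>
      LinearMap.toContinuousLinearMap (Matrix.toLin' A) := by
    exact LinearMap.continuous_of_finiteDimensional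
      ((LinearMap.toContinuousLinearMap (𝕜 := ℂ) (E := Fin m → ℂ) (F' := Fin m → ℂ)).toLinearMap ∘ₗ
        (Matrix.toLin' (R := ℂ) (m := Fin m) (n := Fin m)).toLinearMap)
  have ho := (isOpen_setOfPred_nat_le_rank (𝕜 := ℂ) (E := Fin m → ℂ) (F := Fin m → ℂ)
    (d + 1)).preimage hc
  rw [← isOpen_compl_iff]
  convert ho using 1
  ext A
  have : (Matrix.toLin' A).rank = (A.rank : Cardinal) := by
    rw [Matrix.rank, Module.finrank_eq_rank]; rfl
  simp only [Set.mem_compl_iff, Set.mem_setOf_eq, Set.mem_preimage,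
    LinearMap.coe_toContinuousLinearMap, this]
  rw [Nat.cast_le]
  omega

theorem closure_skew_rank_eq (n k : ℕ) (hk : k ≤ n) :
    closure {A : Matrix (Fin (2 * n)) (Fin (2 * n)) ℂ | Aᵀ = -A ∧ A.rank = 2 * k}
      = {A : Matrix (Fin (2 * n)) (Fin (2 * n)) ℂ | Aᵀ = -A ∧ A.rank ≤ 2 * k} := by
  apply Set.Subset.antisymm
  · apply closure_minimal
    · rintro A ⟨h1, h2⟩
      exact ⟨h1, h2.le⟩
    · exact (isClosed_eq (by fun_prop) (by fun_prop)).inter (aux_closed _ _)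
  · rintro A ⟨hA, hr⟩
    obtain ⟨Q, L, hLQ, hQ⟩ := aux_factor hk A hr
    have hQT : Qᵀ * Lᵀ = 1 := by rw [← transpose_mul, hLQ, transpose_one]
    have hQ' : A * Lᵀ * Qᵀ = A := by
      have := congrArg transpose hQ
      rw [transpose_mul, transpose_mul, hA] at this
      simpa using this
    set M := L * A * Lᵀ with hM
    have hMt : Mᵀ = -M := by
      simp [hM, transpose_mul, hA, Matrix.mul_assoc]
    have hAM : Q * M * Qᵀ = A := by
      calc Q * M * Qᵀ = Q * (L * (A * Lᵀ * Qᵀ)) := by simp only [hM, Matrix.mul_assoc]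
        _ = A := by rw [hQ', hQ]
    set J := Matrix.J (Fin k) ℂ with hJ
    have hJt : Jᵀ = -J := Matrix.J_transpose _ _
    have hJJ : J * J = -1 := Matrix.J_squared _ _
    let f : ℂ → Matrix (Fin (2 * n)) (Fin (2 * n)) ℂ := fun t => Q * (M + t • J) * Qᵀ
    have hf : Continuous f := by fun_prop
    have hf0 : f 0 = A := by simp [f, hAM]
    have hdet : ∀ t, (J * M).charpoly.eval t ≠ 0 → (M + t • J).det ≠ 0 := by
      intro t ht h0
      apply ht
      rw [Matrix.eval_charpoly]
      have : Matrix.scalar _ t - J * M = (-J) * (M + t • J) := by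
        rw [Matrix.mul_add, Matrix.mul_smul, Matrix.neg_mul, Matrix.neg_mul, hJJ, neg_neg,
          Matrix.scalar_apply, ← Matrix.smul_one_eq_diagonal]
        abel
      rw [this, Matrix.det_mul, h0, mul_zero]
    have hev : ∀ᶠ t in nhdsWithin (0 : ℂ) {0}ᶜ, (J * M).charpoly.eval t ≠ 0 := by
      have hfin : {t | (J * M).charpoly.IsRoot t}.Finite :=
        Polynomial.finite_setOf_isRoot (Matrix.charpoly_monic _).ne_zero
      have := hfin.isClosed.isOpen_compl
      have h2 := (hfin.subset (Set.diff_subset (t := {(0 : ℂ)}))).isClosed.isOpen_compl.mem_nhds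
        (x := (0 : ℂ)) (by simp)
      filter_upwards [mem_nhdsWithin_of_mem_nhds h2, self_mem_nhdsWithin] with t ht ht0 hz
      exact ht ⟨hz, ht0⟩
    have htend : Filter.Tendsto f (nhdsWithin (0 : ℂ) {0}ᶜ) (nhds A) := by
      rw [← hf0]
      exact hf.continuousAt.tendsto.mono_left nhdsWithin_le_nhds
    apply mem_closure_of_tendsto htend
    filter_upwards [hev] with t ht
    have hN := hdet t ht
    have hNr : (M + t • J).rank = 2 * k := by
      rw [Matrix.rank_of_det_ne_zero hN]; simp; omega
    refine ⟨?_, ?_⟩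
    · simp only [f, transpose_mul, transpose_add, transpose_smul, transpose_transpose, hMt, hJt]
      rw [← Matrix.mul_assoc, smul_neg, ← neg_add, Matrix.mul_neg, Matrix.neg_mul]
    · apply le_antisymm
      · rw [← hNr]
        exact (Matrix.rank_mul_le_left _ _).trans (Matrix.rank_mul_le_right _ _)
      · have : L * f t * Lᵀ = M + t • J := by
          calc L * f t * Lᵀ = (L * Q) * (M + t • J) * (Qᵀ * Lᵀ) := by
                simp only [f, Matrix.mul_assoc]
            _ = _ := by rw [hLQ, hQT, Matrix.one_mul, Matrix.mul_one]
        rw [← hNr, ← this]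
        exact (Matrix.rank_mul_le_left _ _).trans (Matrix.rank_mul_le_right _ _)
end

section
/- Let n k : ℕ with k ≤ n. Let ι(n) = {p : Fin (2*n) × Fin (2*n) // p.1 < p.2}. Let S = {A : Matrix (Fin (2*n)) (Fin (2*n)) ℂ | Aᵀ = −A ∧ A.rank ≤ 2*k}, and let I ⊆ MvPolynomial (ι(n)) ℂ be the vanishing ideal of S, i.e. I = {f | ∀ A ∈ S, eval (fun ⟨i,j⟩ => A i j) f = 0}. Then the Krull dimension of the quotient ring MvPolynomial (ι(n)) ℂ ⧸ I equals k * (4*n − 2*k − 1). -/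
open Matrix

/-- Index type for the entries of a skew-symmetric `2n × 2n` matrix (entries above
the diagonal): pairs `(i, j)` with `i < j`. -/
def SkewIdx (n : ℕ) : Type :=
  {p : Fin (2 * n) × Fin (2 * n) // p.1 < p.2}


theorem chain_lift {R S : Type*} [CommRing R] [CommRing S] [Algebra R S] [Algebra.IsIntegral R S]
    (hinj : Function.Injective (algebraMap R S)) (p : LTSeries (PrimeSpectrum R)) :
    ∃ q : LTSeries (PrimeSpectrum S), q.length = p.length ∧
      PrimeSpectrum.comap (algebraMap R S) q.last = p.last := by
  induction p using RelSeries.inductionOn' with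
  | singleton x =>
    obtain ⟨Q, -, hQ, h⟩ := Ideal.exists_ideal_over_prime_of_isIntegral x.asIdeal (⊥ : Ideal S)
      (by
        intro a ha
        have : a = 0 := hinj (by simpa using ha)
        simp [this])
    exact ⟨RelSeries.singleton _ ⟨Q, hQ⟩, rfl, PrimeSpectrum.ext (by simpa using h)⟩
  | snoc p x hx ih =>
    obtain ⟨q, hq, hl⟩ := ih
    have hx' : p.last < x := hx
    have hle : q.last.asIdeal.comap (algebraMap R S) ≤ x.asIdeal := by
      have : (PrimeSpectrum.comap (algebraMap R S) q.last).asIdeal ≤ x.asIdeal := by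
        rw [hl]; exact hx'.le
      simpa using this
    obtain ⟨Q, h1, hQ, h⟩ := Ideal.exists_ideal_over_prime_of_isIntegral x.asIdeal q.last.asIdeal hle
    have hlt : q.last < ⟨Q, hQ⟩ := by
      refine lt_of_le_of_ne h1 ?_
      intro he
      apply hx'.ne
      rw [← hl, he]
      exact PrimeSpectrum.ext (by simpa using h)
    refine ⟨q.snoc ⟨Q, hQ⟩ hlt, by simp [hq], ?_⟩
    rw [RelSeries.last_snoc, RelSeries.last_snoc]
    exact PrimeSpectrum.ext (by simpa using h)

theorem dim_integral {R S : Type*} [CommRing R] [CommRing S] [Algebra R S] [Algebra.IsIntegral R S]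
    (hinj : Function.Injective (algebraMap R S)) : ringKrullDim S = ringKrullDim R := by
  apply le_antisymm
  · refine Order.krullDim_le_of_strictMono (PrimeSpectrum.comap (algebraMap R S)) ?_
    intro a b hab
    exact Ideal.IsIntegral.comap_lt_comap (R := R) (I := a.asIdeal) (J := b.asIdeal) hab
  · refine iSup_le fun p => ?_
    obtain ⟨q, hq, -⟩ := chain_lift hinj p
    rw [← hq]
    exact le_iSup (fun q : LTSeries (PrimeSpectrum S) => ((q.length : ℕ) : WithBot ℕ∞)) q

theorem dim_eq_trdeg {R : Type} [CommRing R] [IsDomain R] [Algebra ℂ R] [Algebra.FiniteType ℂ R]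
    {σ : Type} [Fintype σ] (x : σ → R) (hx : IsTranscendenceBasis ℂ x) :
    ringKrullDim R = (Fintype.card σ : ℕ) := by
  obtain ⟨s, g, hg, hint⟩ := exists_integral_inj_algHom_of_fg ℂ R
  let := g.toRingHom.toAlgebra
  have : IsScalarTower ℂ (MvPolynomial (Fin s) ℂ) R := .of_algebraMap_eq fun c => (g.commutes c).symm
  have : Algebra.IsIntegral (MvPolynomial (Fin s) ℂ) R := ⟨hint⟩
  have hinj : Function.Injective (algebraMap (MvPolynomial (Fin s) ℂ) R) := hg
  rw [dim_integral hinj, MvPolynomial.ringKrullDim_of_isNoetherianRing, ringKrullDim_eq_zero_of_field]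
  have : FaithfulSMul (MvPolynomial (Fin s) ℂ) R := (faithfulSMul_iff_algebraMap_injective _ _).mpr hinj
  have h1 := trdeg_add_eq ℂ (MvPolynomial (Fin s) ℂ) (A := R)
  rw [← hx.cardinalMk_eq_trdeg] at h1
  rw [trdeg_eq_zero (R := MvPolynomial (Fin s) ℂ) (A := R)] at h1
  simp at h1
  simp [h1]

instance instFintypeSkewIdx (n : ℕ) : Fintype (SkewIdx n) :=
  inferInstanceAs (Fintype {p : Fin (2 * n) × Fin (2 * n) // p.1 < p.2})

/-- Free coordinates. -/
abbrev FreeIdx (n k : ℕ) : Type := {v : SkewIdx n // (v.1.1 : ℕ) < 2 * k}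

theorem sum_aux (N : ℕ) : ∀ m ≤ N, 2 * ∑ i ∈ Finset.range m, (N - 1 - i) = m * (2 * N - m - 1) := by
  intro m
  induction m with
  | zero => simp
  | succ m ih =>
    intro h
    rw [Finset.sum_range_succ, mul_add, ih (by omega)]
    obtain ⟨d, rfl⟩ := Nat.exists_eq_add_of_le h
    have h1 : 2 * (m + 1 + d) - m - 1 = m + 1 + 2 * d := by omega
    have h2 : m + 1 + d - 1 - m = d := by omega
    have h3 : 2 * (m + 1 + d) - (m + 1) - 1 = m + 2 * d := by omega
    rw [h1, h2, h3]; ring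

theorem card_free (n k : ℕ) (hk : k ≤ n) :
    Fintype.card (FreeIdx n k) = k * (4 * n - 2 * k - 1) := by
  have h2 : 2 * k ≤ 2 * n := by omega
  let e : FreeIdx n k ≃ (Σ i : Fin (2 * k), {j : Fin (2 * n) // Fin.castLE h2 i < j}) :=
    { toFun := fun v => ⟨⟨v.1.1.1, v.2⟩, ⟨v.1.1.2, v.1.2⟩⟩
      invFun := fun w => ⟨⟨(Fin.castLE h2 w.1, w.2.1), w.2.2⟩, w.1.2⟩
      left_inv := fun v => rfl
      right_inv := fun w => rfl }
  rw [Fintype.card_congr e, Fintype.card_sigma]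
  have : ∀ i : Fin (2 * k), Fintype.card {j : Fin (2 * n) // Fin.castLE h2 i < j} = 2 * n - 1 - i := by
    intro i
    rw [Fintype.card_subtype]
    have := Fin.card_Ioi (Fin.castLE h2 i)
    simp only [Fin.val_castLE] at this
    rw [← this]
    congr 1
    ext j; simp
  simp_rw [this]
  rw [Fin.sum_univ_eq_sum_range (fun i => 2 * n - 1 - i)]
  have h := sum_aux (2 * n) (2 * k) h2
  have h3 : 2 * (2 * n) - 2 * k - 1 = 4 * n - 2 * k - 1 := by omega
  rw [h3, mul_assoc] at h
  omega

/-- generic skew matrix -/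
def gen {R : Type*} [CommRing R] (n : ℕ) (v : SkewIdx n → R) : Matrix (Fin (2 * n)) (Fin (2 * n)) R :=
  fun i j => if h : i < j then v ⟨(i, j), h⟩ else if h : j < i then - v ⟨(j, i), h⟩ else 0

theorem gen_lt {R : Type*} [CommRing R] {n : ℕ} (v : SkewIdx n → R) (w : SkewIdx n) :
    gen n v w.1.1 w.1.2 = v w := by
  simp only [gen]
  rw [dif_pos w.2]
  rfl

theorem gen_transpose {R : Type*} [CommRing R] {n : ℕ} (v : SkewIdx n → R) :
    (gen n v)ᵀ = - gen n v := by
  ext i j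
  rw [transpose_apply, Matrix.neg_apply]
  simp only [gen]
  rcases lt_trichotomy i j with h | h | h
  · simp [h, h.not_gt]
  · simp [h]
  · simp [h, h.not_gt]

theorem gen_map {R S : Type*} [CommRing R] [CommRing S] (f : R →+* S) {n : ℕ} (v : SkewIdx n → R) :
    (gen n v).map f = gen n (fun w => f (v w)) := by
  ext i j
  simp only [gen, map_apply]
  split_ifs <;> simp

theorem gen_of_skew {n : ℕ} (A : Matrix (Fin (2 * n)) (Fin (2 * n)) ℂ) (hA : Aᵀ = -A) :
    gen n (fun w => A w.1.1 w.1.2) = A := by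
  have h : ∀ i j, A j i = - A i j := fun i j => congrFun (congrFun hA i) j
  ext i j
  simp only [gen]
  rcases lt_trichotomy i j with h1 | h1 | h1
  · simp [h1]
  · subst h1
    have := h i i
    simp only [lt_irrefl, dite_false]
    linear_combination (-1/2 : ℂ) * this
  · simp [h1, h1.not_gt, h i j]

theorem exists_invertible (k : ℕ) : ∃ v : SkewIdx k → ℂ, (gen k v).det ≠ 0 := by
  let e : Fin k ⊕ Fin k ≃ Fin (2 * k) := finSumFinEquiv.trans (finCongr (by omega))
  let M := Matrix.reindex e e (Matrix.J (Fin k) ℂ)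
  refine ⟨fun w => M w.1.1 w.1.2, ?_⟩
  rw [gen_of_skew]
  · simp only [M, Matrix.det_reindex_self]
    exact (Matrix.isUnit_det_J (Fin k) ℂ).ne_zero
  · simp only [M, reindex_apply, transpose_submatrix, Matrix.J_transpose]
    rfl

theorem det_aux {R : Type*} [CommRing R] {m : Type*} [Fintype m] [DecidableEq m]
    (P : Matrix m m R) (q : Matrix m Unit R) (r : Matrix Unit m R) (d : Matrix Unit Unit R) :
    (fromBlocks P q r d).det = (fromBlocks P q r 0).det + P.det * d () () := by
  have h1 : fromBlocks P q r d = (fromBlocks P q r 0).updateRow (Sum.inr ())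
      (Sum.elim (r ()) 0 + Sum.elim (0 : m → R) (d ())) := by
    ext i j
    rcases i with i | i <;> rcases j with j | j <;> simp [updateRow_apply]
  have h2 : fromBlocks P q r 0 = (fromBlocks P q r 0).updateRow (Sum.inr ()) (Sum.elim (r ()) 0) := by
    ext i j
    rcases i with i | i <;> rcases j with j | j <;> simp [updateRow_apply]
  have h3 : fromBlocks P q (0 : Matrix Unit m R) d = (fromBlocks P q r 0).updateRow (Sum.inr ()) (Sum.elim (0 : m → R) (d ())) := by
    ext i j
    rcases i with i | i <;> rcases j with j | j <;> simp [updateRow_apply]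
  rw [h1, det_updateRow_add, ← h2, ← h3, det_fromBlocks_zero₂₁, det_unique d]

theorem skew_decomp (n k : ℕ) (A : Matrix (Fin (2 * n)) (Fin (2 * n)) ℂ) (hA : Aᵀ = -A)
    (hr : A.rank ≤ 2 * k) :
    ∃ (B : Matrix (Fin (2 * n)) (Fin (2 * k)) ℂ) (N : Matrix (Fin (2 * k)) (Fin (2 * k)) ℂ),
      Nᵀ = -N ∧ A = B * N * Bᵀ := by
  let W := LinearMap.range A.mulVecLin
  have hW : Module.finrank ℂ W ≤ Module.finrank ℂ (Fin (2 * k) → ℂ) := by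
    rw [Module.finrank_fin_fun]; exact hr
  obtain ⟨f, hf⟩ : ∃ f : W →ₗ[ℂ] (Fin (2 * k) → ℂ), Function.Injective f := by
    rw [← rank_le_iff_exists_linearMap, ← Module.finrank_eq_rank, ← Module.finrank_eq_rank]
    exact_mod_cast hW
  obtain ⟨g, hg⟩ := f.exists_leftInverse_of_injective (LinearMap.ker_eq_bot.mpr hf)
  obtain ⟨π, hπ⟩ := W.subtype.exists_leftInverse_of_injective (Submodule.ker_subtype W)
  let B := LinearMap.toMatrix' (W.subtype ∘ₗ g)
  let L := LinearMap.toMatrix' (f ∘ₗ π)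
  have h1 : B * L * A = A := by
    have : (W.subtype ∘ₗ g) ∘ₗ (f ∘ₗ π) ∘ₗ A.mulVecLin = A.mulVecLin := by
      refine LinearMap.ext fun x => ?_
      have e1 : π (A.mulVecLin x) = ⟨A.mulVecLin x, LinearMap.mem_range_self _ x⟩ :=
        LinearMap.congr_fun hπ (⟨A.mulVecLin x, LinearMap.mem_range_self _ x⟩ : W)
      have e2 : ∀ w, g (f w) = w := fun w => LinearMap.congr_fun hg w
      simp only [LinearMap.comp_apply, e1, e2]
      rfl
    have h2 := congrArg LinearMap.toMatrix' this
    rw [LinearMap.toMatrix'_comp, LinearMap.toMatrix'_comp, ← Matrix.toLin'_apply',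
      LinearMap.toMatrix'_toLin', ← Matrix.mul_assoc] at h2
    exact h2
  refine ⟨B, L * A * Lᵀ, ?_, ?_⟩
  · simp [Matrix.transpose_mul, hA, Matrix.mul_assoc]
  · have h2 : A * (B * L)ᵀ = A := by
      have := congrArg Matrix.transpose h1
      rw [Matrix.transpose_mul, hA, Matrix.neg_mul, neg_inj] at this
      exact this
    calc A = (B * L * A) * (B * L)ᵀ := by rw [h1, h2]
      _ = _ := by simp only [Matrix.transpose_mul, Matrix.mul_assoc]

theorem rank_triple {m l : ℕ} (B : Matrix (Fin m) (Fin l) ℂ) (N : Matrix (Fin l) (Fin l) ℂ) :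
    (B * N * Bᵀ).rank ≤ l := by
  rw [Matrix.mul_assoc]
  refine (Matrix.rank_mul_le_left _ _).trans ?_
  simpa using Matrix.rank_le_width B

theorem minor_zero {m l : ℕ} (A : Matrix (Fin m) (Fin m) ℂ) (hA : A.rank ≤ l)
    (f g : Fin l ⊕ Unit → Fin m) : (A.submatrix f g).det = 0 := by
  by_contra h
  have h1 : (A.submatrix f g).rank = l + 1 := by
    rw [Matrix.rank_of_isUnit _ ((Matrix.isUnit_iff_isUnit_det _).mpr (isUnit_iff_ne_zero.mpr h))]
    simp
  have h2 := Matrix.rank_submatrix_le A f g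
  omega

theorem isPrime_aux (n k : ℕ)
    (I : Ideal (MvPolynomial (SkewIdx n) ℂ))
    (hI : ∀ f : MvPolynomial (SkewIdx n) ℂ,
      f ∈ I ↔ ∀ A : Matrix (Fin (2 * n)) (Fin (2 * n)) ℂ,
        Aᵀ = -A → A.rank ≤ 2 * k →
          MvPolynomial.eval (fun v : SkewIdx n => A v.1.1 v.1.2) f = 0) : I.IsPrime := by
  let τ := (Fin (2 * n) × Fin (2 * k)) ⊕ SkewIdx k
  let B : Matrix (Fin (2 * n)) (Fin (2 * k)) (MvPolynomial τ ℂ) :=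
    fun i j => MvPolynomial.X (Sum.inl (i, j))
  let N : Matrix (Fin (2 * k)) (Fin (2 * k)) (MvPolynomial τ ℂ) :=
    gen k (fun w => MvPolynomial.X (Sum.inr w))
  let φ : MvPolynomial (SkewIdx n) ℂ →ₐ[ℂ] MvPolynomial τ ℂ :=
    MvPolynomial.aeval (fun v : SkewIdx n => (B * N * Bᵀ) v.1.1 v.1.2)
  have key : ∀ (B' : Matrix (Fin (2 * n)) (Fin (2 * k)) ℂ) (w : SkewIdx k → ℂ)
      (f : MvPolynomial (SkewIdx n) ℂ),
      MvPolynomial.eval (Sum.elim (fun p => B' p.1 p.2) w) (φ f) =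
        MvPolynomial.eval (fun v : SkewIdx n => (B' * gen k w * B'ᵀ) v.1.1 v.1.2) f := by
    intro B' w f
    have hB : B.map (MvPolynomial.eval (Sum.elim (fun p => B' p.1 p.2) w)) = B' := by
      ext i j
      rw [Matrix.map_apply]
      simp only [B, MvPolynomial.eval_X, Sum.elim_inl]
    have hN : N.map (MvPolynomial.eval (Sum.elim (fun p => B' p.1 p.2) w)) = gen k w := by
      simp only [N, gen_map, MvPolynomial.eval_X, Sum.elim_inr]
    have h1 : (B * N * Bᵀ).map (MvPolynomial.eval (Sum.elim (fun p => B' p.1 p.2) w)) =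
        B' * gen k w * B'ᵀ := by
      rw [Matrix.map_mul, Matrix.map_mul, Matrix.transpose_map, hB, hN]
    rw [← h1]
    have h2 : (MvPolynomial.eval (Sum.elim (fun p => B' p.1 p.2) w)).comp φ.toRingHom =
        MvPolynomial.eval (fun v : SkewIdx n => ((B * N * Bᵀ).map
          (MvPolynomial.eval (Sum.elim (fun p => B' p.1 p.2) w))) v.1.1 v.1.2) := by
      apply MvPolynomial.ringHom_ext
      · intro a; simp [φ]
      · intro v; simp [φ, -Matrix.map_mul]
    exact RingHom.congr_fun h2 f
  have : I = RingHom.ker φ := by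
    ext f
    rw [hI, RingHom.mem_ker]
    constructor
    · intro h
      apply MvPolynomial.funext
      intro c
      have hc : c = Sum.elim
          (fun p => (Matrix.of fun i j => c (Sum.inl (i, j)) :
            Matrix (Fin (2 * n)) (Fin (2 * k)) ℂ) p.1 p.2) (fun w => c (Sum.inr w)) := by
        funext t; rcases t with t | t <;> rfl
      rw [hc, key, map_zero]
      refine h _ ?_ (rank_triple _ _)
      simp only [Matrix.transpose_mul, Matrix.transpose_transpose, gen_transpose,
        Matrix.mul_assoc, Matrix.neg_mul, Matrix.mul_neg]
    · intro h A hA hr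
      obtain ⟨B', N', hN', rfl⟩ := skew_decomp n k A hA hr
      have := key B' (fun w => N' w.1.1 w.1.2) f
      rw [h, map_zero, gen_of_skew N' hN'] at this
      exact this.symm
  rw [this]
  exact RingHom.ker_isPrime _

/-- embedding of indices -/
def embIdx {n k : ℕ} (h : 2 * k ≤ 2 * n) (w : SkewIdx k) : FreeIdx n k :=
  ⟨⟨(Fin.castLE h w.1.1, Fin.castLE h w.1.2), w.2⟩, w.1.1.2⟩

theorem embIdx_injective {n k : ℕ} (h : 2 * k ≤ 2 * n) :
    Function.Injective (embIdx (n := n) (k := k) h) := by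
  intro a b hab
  have h1 := congrArg (fun z : FreeIdx n k => (z.1.1.1 : ℕ)) hab
  have h2 := congrArg (fun z : FreeIdx n k => (z.1.1.2 : ℕ)) hab
  exact Subtype.ext (Prod.ext (Fin.ext h1) (Fin.ext h2))

theorem gen_corner {R : Type*} [CommRing R] {n k : ℕ} (h : 2 * k ≤ 2 * n) (v : SkewIdx n → R) :
    (gen n v).submatrix (Fin.castLE h) (Fin.castLE h) = gen k (fun w => v (embIdx h w).1) := by
  ext i j
  simp only [gen, submatrix_apply, embIdx, Fin.castLE_lt_castLE_iff]

/-- the generic corner Pfaffian squared -/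
noncomputable def cornerDet (n k : ℕ) (h : 2 * k ≤ 2 * n) : MvPolynomial (FreeIdx n k) ℂ :=
  (gen k (fun w => MvPolynomial.X (embIdx h w))).det

theorem cornerDet_map {n k : ℕ} (h : 2 * k ≤ 2 * n) {S : Type*} [CommRing S]
    (f : MvPolynomial (FreeIdx n k) ℂ →+* S) :
    f (cornerDet n k h) = (gen k (fun w => f (MvPolynomial.X (embIdx h w)))).det := by
  rw [cornerDet, RingHom.map_det, RingHom.mapMatrix_apply, gen_map]

theorem cornerDet_ne_zero {n k : ℕ} (h : 2 * k ≤ 2 * n) : cornerDet n k h ≠ 0 := by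
  obtain ⟨v, hv⟩ := exists_invertible k
  intro h0
  have h1 := cornerDet_map h (MvPolynomial.eval (Function.extend (embIdx h) v 0))
  simp only [h0, map_zero, MvPolynomial.eval_X, (embIdx_injective h).extend_apply] at h1
  exact hv h1.symm

theorem exists_ext {n k : ℕ} (h : 2 * k ≤ 2 * n) (c : FreeIdx n k → ℂ)
    (hc : (gen k (fun w => c (embIdx h w))).det ≠ 0) :
    ∃ A : Matrix (Fin (2 * n)) (Fin (2 * n)) ℂ, Aᵀ = -A ∧ A.rank ≤ 2 * k ∧
      ∀ v : FreeIdx n k, A v.1.1.1 v.1.1.2 = c v := by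
  let v0 : SkewIdx n → ℂ := Function.extend Subtype.val c 0
  have hv0 : ∀ v : FreeIdx n k, v0 v.1 = c v := fun v => Subtype.val_injective.extend_apply c 0 v
  let A0 := gen n v0
  let P := gen k (fun w => c (embIdx h w))
  let C : Matrix (Fin (2 * n)) (Fin (2 * k)) ℂ := A0.submatrix id (Fin.castLE h)
  have hP : A0.submatrix (Fin.castLE h) (Fin.castLE h) = P := by
    simp only [A0, P, gen_corner, hv0]
  have hPt : Pᵀ = -P := gen_transpose _
  have hPi : (P⁻¹)ᵀ = -P⁻¹ := by
    rw [Matrix.transpose_nonsing_inv, hPt]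
    apply Matrix.inv_eq_right_inv
    rw [neg_mul_neg]
    exact Matrix.mul_nonsing_inv _ (isUnit_iff_ne_zero.mpr hc)
  have hA0 : A0ᵀ = -A0 := gen_transpose _
  refine ⟨C * (-P⁻¹) * Cᵀ, ?_, rank_triple _ _, ?_⟩
  · simp only [Matrix.transpose_mul, Matrix.transpose_transpose, Matrix.transpose_neg, hPi,
        Matrix.mul_assoc, Matrix.neg_mul, Matrix.mul_neg]
  · intro v
    have h1 : (C * (-P⁻¹) * Cᵀ).submatrix (Fin.castLE h) id = A0.submatrix (Fin.castLE h) id := by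
      have e1 : (C * (-P⁻¹) * Cᵀ).submatrix (Fin.castLE h) id
          = C.submatrix (Fin.castLE h) id * (-P⁻¹) * Cᵀ := by
        ext i j; simp [Matrix.mul_apply]
      have e2 : C.submatrix (Fin.castLE h) id = P := by rw [← hP]; rfl
      rw [e1, e2, Matrix.mul_neg, Matrix.mul_nonsing_inv _ (isUnit_iff_ne_zero.mpr hc)]
      ext i j
      have := congrFun (congrFun hA0 (Fin.castLE h i)) j
      simp only [C]
      simp at this
      simp [this]
    have h2 := congrFun (congrFun h1 ⟨v.1.1.1, v.2⟩) v.1.1.2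
    have h3 : A0 v.1.1.1 v.1.1.2 = c v := by rw [← hv0 v]; exact gen_lt v0 v.1
    rw [← h3]
    exact h2

theorem basis_aux (n k : ℕ) (hk : k ≤ n)
    (I : Ideal (MvPolynomial (SkewIdx n) ℂ)) [I.IsPrime]
    (hI : ∀ f : MvPolynomial (SkewIdx n) ℂ,
      f ∈ I ↔ ∀ A : Matrix (Fin (2 * n)) (Fin (2 * n)) ℂ,
        Aᵀ = -A → A.rank ≤ 2 * k →
          MvPolynomial.eval (fun v : SkewIdx n => A v.1.1 v.1.2) f = 0) :
    IsTranscendenceBasis ℂ (fun v : FreeIdx n k =>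
      (Ideal.Quotient.mk I (MvPolynomial.X v.1) : MvPolynomial (SkewIdx n) ℂ ⧸ I)) := by
  have h : 2 * k ≤ 2 * n := by omega
  set x : FreeIdx n k → MvPolynomial (SkewIdx n) ℂ ⧸ I :=
    fun v => Ideal.Quotient.mk I (MvPolynomial.X v.1) with hx
  have hae : ∀ p : MvPolynomial (FreeIdx n k) ℂ,
      MvPolynomial.aeval x p = Ideal.Quotient.mk I (MvPolynomial.rename Subtype.val p) := by
    intro p
    have : MvPolynomial.aeval x = (Ideal.Quotient.mkₐ ℂ I).comp
        (MvPolynomial.rename (Subtype.val : FreeIdx n k → SkewIdx n)) := by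
      ext v; simp [hx]
    rw [this]; rfl
  have hind : AlgebraicIndependent ℂ x := by
    rw [algebraicIndependent_iff]
    intro p hp
    rw [hae, Ideal.Quotient.eq_zero_iff_mem, hI] at hp
    have h0 : p * cornerDet n k h = 0 := by
      apply MvPolynomial.funext
      intro c
      rw [map_mul, map_zero, cornerDet_map]
      simp only [MvPolynomial.eval_X]
      by_cases hc : (gen k (fun w => c (embIdx h w))).det = 0
      · rw [hc, mul_zero]
      · obtain ⟨A, hA, hr, hAc⟩ := exists_ext h c hc
        have := hp A hA hr
        rw [MvPolynomial.eval_rename] at this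
        have e : ((fun v : SkewIdx n => A v.1.1 v.1.2) ∘ (Subtype.val : FreeIdx n k → SkewIdx n)) = c :=
          funext hAc
        rw [e] at this
        rw [this, zero_mul]
    exact (mul_eq_zero.mp h0).resolve_right (cornerDet_ne_zero h)
  rw [hind.isTranscendenceBasis_iff_isAlgebraic]
  set S := Algebra.adjoin ℂ (Set.range x) with hS
  let Y : Matrix (Fin (2 * n)) (Fin (2 * n)) (MvPolynomial (SkewIdx n) ℂ ⧸ I) :=
    gen n (fun v => Ideal.Quotient.mk I (MvPolynomial.X v))
  have hYlt : ∀ i j : Fin (2 * n), (i : ℕ) < 2 * k → i < j → Y i j ∈ S := by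
    intro i j hi hij
    have := gen_lt (fun v => Ideal.Quotient.mk I (MvPolynomial.X v)) (⟨(i, j), hij⟩ : SkewIdx n)
    have e : Y i j = x ⟨⟨(i, j), hij⟩, hi⟩ := this
    rw [e]
    exact Algebra.subset_adjoin ⟨_, rfl⟩
  have hYt : ∀ i j, Y j i = - Y i j := fun i j =>
    congrFun (congrFun (gen_transpose
      (fun v => Ideal.Quotient.mk I (MvPolynomial.X v))) i) j
  have hYd : ∀ i, Y i i = 0 := fun i => by simp [Y, gen]
  have hY : ∀ i j : Fin (2 * n), (i : ℕ) < 2 * k ∨ (j : ℕ) < 2 * k → Y i j ∈ S := by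
    intro i j hij
    rcases lt_trichotomy i j with h1 | h1 | h1
    · refine hYlt i j ?_ h1
      have : (i : ℕ) < j := h1
      omega
    · rw [h1, hYd]; exact S.zero_mem
    · rw [hYt j i]
      refine S.neg_mem (hYlt j i ?_ h1)
      have : (j : ℕ) < i := h1
      omega
  have hdet : ∀ {m : Type} [Fintype m] [DecidableEq m]
      (M : Matrix m m (MvPolynomial (SkewIdx n) ℂ ⧸ I)), (∀ i j, M i j ∈ S) → M.det ∈ S := by
    intro m _ _ M hM
    rw [Matrix.det_apply']
    refine S.sum_mem fun σ _ => S.mul_mem ?_ (S.prod_mem fun i _ => hM _ _)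
    exact S.intCast_mem _
  let P := Y.submatrix (Fin.castLE h) (Fin.castLE h)
  have hPS : P.det ∈ S := hdet P fun i j => hY _ _ (Or.inl i.2)
  have hP0 : P.det ≠ 0 := by
    have : P.det = MvPolynomial.aeval x (cornerDet n k h) := by
      have := cornerDet_map h (MvPolynomial.aeval x : MvPolynomial (FreeIdx n k) ℂ →ₐ[ℂ] _).toRingHom
      refine Eq.trans ?_ this.symm
      simp only [P, Y, gen_corner]
      simp [hx]
    rw [this]
    intro h0
    exact cornerDet_ne_zero h ((algebraicIndependent_iff.mp hind) _ h0)
  have hgen : ∀ v : SkewIdx n, IsAlgebraic S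
      (Ideal.Quotient.mk I (MvPolynomial.X v) : MvPolynomial (SkewIdx n) ℂ ⧸ I) := by
    intro v
    let f : Fin (2 * k) ⊕ Unit → Fin (2 * n) := Sum.elim (Fin.castLE h) (fun _ => v.1.1)
    let g : Fin (2 * k) ⊕ Unit → Fin (2 * n) := Sum.elim (Fin.castLE h) (fun _ => v.1.2)
    have hminor : (Y.submatrix f g).det = 0 := by
      have e1 : (Y.submatrix f g).det = Ideal.Quotient.mk I
          (((gen n (fun v => (MvPolynomial.X v : MvPolynomial (SkewIdx n) ℂ))).submatrix f g).det) := by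
        rw [RingHom.map_det, RingHom.mapMatrix_apply, ← Matrix.submatrix_map, gen_map]
      rw [e1, Ideal.Quotient.eq_zero_iff_mem, hI]
      intro A hA hr
      rw [RingHom.map_det, RingHom.mapMatrix_apply, ← Matrix.submatrix_map, gen_map]
      simp only [MvPolynomial.eval_X]
      rw [gen_of_skew A hA]
      exact minor_zero A hr f g
    let q : Matrix (Fin (2 * k)) Unit (MvPolynomial (SkewIdx n) ℂ ⧸ I) :=
      fun i _ => Y (Fin.castLE h i) v.1.2
    let r : Matrix Unit (Fin (2 * k)) (MvPolynomial (SkewIdx n) ℂ ⧸ I) :=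
      fun _ j => Y v.1.1 (Fin.castLE h j)
    let d : Matrix Unit Unit (MvPolynomial (SkewIdx n) ℂ ⧸ I) := fun _ _ => Y v.1.1 v.1.2
    have hblk : Y.submatrix f g = fromBlocks P q r d := by
      ext i j
      rcases i with i | i <;> rcases j with j | j <;> rfl
    rw [hblk, det_aux] at hminor
    have hc : (fromBlocks P q r 0).det ∈ S := by
      apply hdet
      intro i j
      rcases i with i | i <;> rcases j with j | j
      · exact hY _ _ (Or.inl i.2)
      · exact hY _ _ (Or.inl i.2)
      · exact hY _ _ (Or.inr j.2)
      · exact S.zero_mem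
    have hd : d () () = Ideal.Quotient.mk I (MvPolynomial.X v) := gen_lt _ v
    rw [hd] at hminor
    refine ⟨Polynomial.C ⟨_, hPS⟩ * Polynomial.X + Polynomial.C ⟨_, hc⟩, ?_, ?_⟩
    · intro h0
      have := congrArg (fun p => Polynomial.coeff p 1) h0
      simp [Polynomial.coeff_C] at this
      exact hP0 (congrArg Subtype.val this)
    · simp only [map_add, map_mul, Polynomial.aeval_C, Polynomial.aeval_X]
      rw [add_comm]
      exact hminor
  refine ⟨fun y => ?_⟩
  obtain ⟨p, rfl⟩ := Ideal.Quotient.mk_surjective y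
  induction p using MvPolynomial.induction_on with
  | C a =>
    exact isAlgebraic_algebraMap (⟨_, S.algebraMap_mem a⟩ : S)
  | add p q hp hq => rw [map_add]; exact hp.add hq
  | mul_X p v hp => rw [map_mul]; exact hp.mul (hgen v)

theorem krullDim_skew_rank_le (n k : ℕ) (hk : k ≤ n)
    (I : Ideal (MvPolynomial (SkewIdx n) ℂ))
    (hI : ∀ f : MvPolynomial (SkewIdx n) ℂ,
      f ∈ I ↔ ∀ A : Matrix (Fin (2 * n)) (Fin (2 * n)) ℂ,
        Aᵀ = -A → A.rank ≤ 2 * k →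
          MvPolynomial.eval (fun v : SkewIdx n => A v.1.1 v.1.2) f = 0) :
    ringKrullDim (MvPolynomial (SkewIdx n) ℂ ⧸ I)
      = (k * (4 * n - 2 * k - 1) : ℕ) := by
  have := isPrime_aux n k I hI
  rw [dim_eq_trdeg _ (basis_aux n k hk I hI), card_free n k hk]
end

section
/- For every n ≥ 1 there exists a polynomial Pf ∈ MvPolynomial (ι(n)) ℂ, homogeneous of degree n, such that Pf * Pf = det (G(n)), where G(n) is the generic skew-symmetric 2n×2n matrix. (This polynomial is the Pfaffian.) -/
open Matrix MvPolynomial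

/-- The generic skew-symmetric `2n × 2n` matrix, whose `(i, j)` entry for `i < j` is
the variable `X ⟨i, j⟩`, whose `(i, j)` entry for `j < i` is `-X ⟨j, i⟩`, and whose
diagonal entries are `0`. -/
noncomputable def genSkew (n : ℕ) :
    Matrix (Fin (2 * n)) (Fin (2 * n)) (MvPolynomial (SkewIdx n) ℂ) :=
  fun i j =>
    if h : i < j then X ⟨(i, j), h⟩
    else if h' : j < i then -(X ⟨(j, i), h'⟩)
    else 0

theorem skew_det_isSquare {K : Type*} [Field K] (N : ℕ) :
    ∀ {m : Type} [Fintype m] [DecidableEq m] (A : Matrix m m K),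
      Fintype.card m ≤ N → Aᵀ = -A → (∀ i, A i i = 0) → (2 : K) ≠ 0 → IsSquare A.det := by
  induction N with
  | zero =>
    intro m _ _ A hc _ _ _
    have : IsEmpty m := Fintype.card_eq_zero_iff.mp (by omega)
    rw [Matrix.det_isEmpty]
    exact IsSquare.one
  | succ N ih =>
    intro m _ _ A hc hA hd h2
    by_cases h0 : A = 0
    · subst h0
      rcases isEmpty_or_nonempty m with h | h
      · rw [Matrix.det_isEmpty]
        exact IsSquare.one
      · rw [Matrix.det_zero]
        exact IsSquare.zero
    have hs : ∀ i j, A j i = - A i j := fun i j => by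
      have := congrFun (congrFun hA i) j
      simpa using this
    obtain ⟨i, j, hij⟩ : ∃ i j, A i j ≠ 0 := by
      by_contra! h
      exact h0 (by ext i j; exact h i j)
    have hne : i ≠ j := by
      rintro rfl
      exact hij (hd i)
    let p : m → Prop := fun k => k = i ∨ k = j
    let e : Fin 2 ≃ {k // p k} := Equiv.ofBijective ![⟨i, Or.inl rfl⟩, ⟨j, Or.inr rfl⟩] (by
      constructor
      · intro a b hab
        fin_cases a <;> fin_cases b
        · rfl
        · exact absurd (congrArg Subtype.val hab) hne
        · exact absurd (congrArg Subtype.val hab) hne.symm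
        · rfl
      · rintro ⟨k, rfl | rfl⟩
        · exact ⟨0, rfl⟩
        · exact ⟨1, rfl⟩)
    have hdet : (toBlock A p p).det = A i j * A i j := by
      rw [← Matrix.det_submatrix_equiv_self e, Matrix.det_fin_two]
      have e0 : (e 0 : m) = i := rfl
      have e1 : (e 1 : m) = j := rfl
      simp only [Matrix.submatrix_apply, toBlock_apply, e0, e1, hd, hs i j]
      ring
    have hu : IsUnit (toBlock A p p).det := by
      rw [hdet]
      exact (mul_ne_zero hij hij).isUnit
    let _ : Invertible (toBlock A p p) := Matrix.invertibleOfIsUnitDet _ hu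
    rw [Matrix.det_toBlock A p, Matrix.det_fromBlocks₁₁, hdet]
    refine (IsSquare.mul_self _).mul ?_
    have hT : ∀ q r : m → Prop, (toBlock A q r)ᵀ = - toBlock A r q := by
      intro q r
      ext a b
      simpa using hs _ _
    have hinv : ((toBlock A p p)⁻¹)ᵀ = -(toBlock A p p)⁻¹ := by
      rw [Matrix.transpose_nonsing_inv, hT]
      apply Matrix.inv_eq_left_inv
      rw [Matrix.neg_mul, Matrix.mul_neg, neg_neg, Matrix.nonsing_inv_mul _ hu]
    rw [Matrix.invOf_eq_nonsing_inv]
    have hS : (toBlock A (fun j => ¬p j) (fun j => ¬p j) -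
        toBlock A (fun j => ¬p j) p * (toBlock A p p)⁻¹ * toBlock A p (fun j => ¬p j))ᵀ =
        -(toBlock A (fun j => ¬p j) (fun j => ¬p j) -
        toBlock A (fun j => ¬p j) p * (toBlock A p p)⁻¹ * toBlock A p (fun j => ¬p j)) := by
      rw [Matrix.transpose_sub, Matrix.transpose_mul, Matrix.transpose_mul, hT, hT, hT, hinv]
      simp only [Matrix.neg_mul, Matrix.mul_neg, neg_neg, Matrix.mul_assoc]
      abel
    refine ih _ ?_ hS ?_ h2
    · have : Fintype.card {k // ¬ p k} < Fintype.card m :=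
        Fintype.card_subtype_lt (x := i) (by simp [p])
      omega
    · intro k
      have := congrFun (congrFun hS k) k
      rw [Matrix.transpose_apply, Matrix.neg_apply, eq_neg_iff_add_eq_zero, ← two_mul] at this
      exact (mul_eq_zero.mp this).resolve_left h2

theorem scale_coeff {σ : Type*} (P : MvPolynomial σ ℂ) : ∀ k,
    ((MvPolynomial.aeval (fun i => Polynomial.C (X i : MvPolynomial σ ℂ) * Polynomial.X) P :
      Polynomial (MvPolynomial σ ℂ)).coeff k).IsHomogeneous k := by
  induction P using MvPolynomial.induction_on with
  | C a =>
    intro k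
    rw [MvPolynomial.aeval_C, Polynomial.algebraMap_apply, Polynomial.coeff_C]
    split_ifs with h
    · subst h
      exact isHomogeneous_C _ _
    · exact isHomogeneous_zero _ _ _
  | add p q hp hq =>
    intro k
    rw [map_add, Polynomial.coeff_add]
    exact (hp k).add (hq k)
  | mul_X p i hp =>
    intro k
    rw [map_mul, aeval_X, ← mul_assoc]
    cases k with
    | zero =>
      rw [Polynomial.coeff_mul_X_zero]
      exact isHomogeneous_zero _ _ _
    | succ k =>
      rw [Polynomial.coeff_mul_X, Polynomial.coeff_mul_C]
      exact (hp k).mul (isHomogeneous_X _ _)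

/-- Existence of the Pfaffian: for `n ≥ 1` there is a homogeneous polynomial `Pf` of
degree `n` in the entries of the generic skew-symmetric `2n × 2n` matrix whose square
is the determinant. -/
theorem exists_pfaffian (n : ℕ) (hn : 1 ≤ n) :
    ∃ Pf : MvPolynomial (SkewIdx n) ℂ,
      Pf.IsHomogeneous n ∧ Pf * Pf = (genSkew n).det := by
  have hskew : ∀ i j, genSkew n j i = - genSkew n i j := by
    intro i j
    unfold genSkew
    rcases lt_trichotomy i j with h | h | h
    · simp [h, h.not_gt]
    · subst h
      simp
    · simp [h, h.not_gt]
  have hdiag : ∀ i, genSkew n i i = 0 := by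
    intro i
    simp [genSkew]
  let R := MvPolynomial (SkewIdx n) ℂ
  let K := FractionRing R
  obtain ⟨P, hP⟩ : ∃ P : R, P * P = (genSkew n).det := by
    have h := skew_det_isSquare (K := K) _ ((genSkew n).map (algebraMap R K)) le_rfl
      (by
        ext i j
        simp only [Matrix.transpose_apply, Matrix.map_apply, Matrix.neg_apply]
        rw [hskew i j, map_neg])
      (by
        intro i
        simp only [Matrix.map_apply]
        rw [hdiag, map_zero])
      (by
        have : (algebraMap R K) 2 ≠ 0 := by
          rw [Ne, IsFractionRing.to_map_eq_zero_iff]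
          exact two_ne_zero
        simpa using this)
    obtain ⟨r, hr⟩ := h
    have hr' : r * r = algebraMap R K (genSkew n).det := by
      rw [← hr, RingHom.map_det]
      rfl
    obtain ⟨P, rfl⟩ := IsIntegrallyClosed.exists_algebraMap_eq_of_isIntegral_pow
      (R := R) (x := r) (n := 2) two_pos (by rw [pow_two, hr']; exact isIntegral_algebraMap)
    refine ⟨P, IsFractionRing.injective R K ?_⟩
    rw [map_mul, hr']
  refine ⟨P, ?_, hP⟩
  let φ : R →ₐ[ℂ] Polynomial R :=
    MvPolynomial.aeval (fun i => Polynomial.C (X i : R) * Polynomial.X)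
  have hφ : φ (genSkew n).det = Polynomial.X ^ (2 * n) * Polynomial.C (genSkew n).det := by
    rw [AlgHom.map_det, RingHom.map_det]
    have : φ.mapMatrix (genSkew n) =
        (Polynomial.X : Polynomial R) • (Polynomial.C.mapMatrix (genSkew n)) := by
      have hX : ∀ s : SkewIdx n, φ (X s) = Polynomial.X * Polynomial.C (X s : R) := fun s => by
        rw [mul_comm]
        exact MvPolynomial.aeval_X _ s
      have hX' : ∀ s : SkewIdx n, φ (-X s) = Polynomial.X * Polynomial.C (-X s : R) := fun s => by
        rw [map_neg, hX, map_neg]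
        ring
      ext1 i j
      simp only [AlgHom.mapMatrix_apply, RingHom.mapMatrix_apply, Matrix.map_apply,
        Matrix.smul_apply, smul_eq_mul, genSkew]
      split_ifs
      · exact hX _
      · exact hX' _
      · simp
    rw [this, Matrix.det_smul, Fintype.card_fin]
  have hsq : φ P * φ P =
      (Polynomial.X ^ n * Polynomial.C P) * (Polynomial.X ^ n * Polynomial.C P) := by
    rw [← map_mul, hP, hφ, ← hP, map_mul]
    ring
  have hcoeff : ∀ k, ((φ P).coeff k).IsHomogeneous k := scale_coeff P
  rcases mul_self_eq_mul_self_iff.mp hsq with h | h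
  · have := hcoeff n
    rw [h] at this
    simpa [Polynomial.coeff_X_pow_mul'] using this
  · have := (hcoeff n).neg
    rw [h] at this
    simpa [Polynomial.coeff_X_pow_mul'] using this
end

section
/- Let n ≥ 1 and let Pf ∈ MvPolynomial (ι(n)) ℂ satisfy Pf * Pf = det (G(n)). Then for every g : Matrix (Fin (2*n)) (Fin (2*n)) ℂ and every skew-symmetric A : Matrix (Fin (2*n)) (Fin (2*n)) ℂ, one has Pf(g * A * gᵀ) = det g * Pf(A), where Pf(B) denotes the evaluation of Pf at the point ⟨i,j⟩ ↦ B i j. -/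
open Matrix MvPolynomial

/-- Evaluation of a polynomial in the entries of the generic skew-symmetric matrix
at a concrete matrix `B`. -/
noncomputable def pfEval (n : ℕ) (Pf : MvPolynomial (SkewIdx n) ℂ)
    (B : Matrix (Fin (2 * n)) (Fin (2 * n)) ℂ) : ℂ :=
  MvPolynomial.eval (fun v : SkewIdx n => B v.1.1 v.1.2) Pf

theorem pf_sq_aux (n : ℕ) (Pf : MvPolynomial (SkewIdx n) ℂ) (hPf : Pf * Pf = (genSkew n).det)
    {S : Type} [CommRing S] [Algebra ℂ S] (B : Matrix (Fin (2 * n)) (Fin (2 * n)) S)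
    (hB : Bᵀ = -B) (hd : ∀ i, B i i = 0) :
    MvPolynomial.aeval (fun v : SkewIdx n => B v.1.1 v.1.2) Pf *
      MvPolynomial.aeval (fun v : SkewIdx n => B v.1.1 v.1.2) Pf = B.det := by
  rw [← map_mul, hPf, AlgHom.map_det]
  congr 1
  ext i j
  rw [AlgHom.mapMatrix_apply, Matrix.map_apply]
  unfold genSkew
  rcases lt_trichotomy i j with h | h | h
  · simp only [h, dite_true]
    exact MvPolynomial.aeval_X _ _
  · subst h
    simp [hd]
  · have := congrFun (congrFun hB i) j
    simp only [Matrix.transpose_apply, Matrix.neg_apply] at this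
    simp only [h, not_lt.2 h.le, dite_true, dite_false, map_neg]
    refine (congrArg Neg.neg (MvPolynomial.aeval_X _ _)).trans ?_
    change -(B j i) = B i j
    rw [this, neg_neg]

theorem pf_eval_aux (n : ℕ) (Pf : MvPolynomial (SkewIdx n) ℂ) (t : ℂ)
    (B : Matrix (Fin (2 * n)) (Fin (2 * n)) (Polynomial ℂ)) :
    Polynomial.eval t (MvPolynomial.aeval (fun v : SkewIdx n => B v.1.1 v.1.2) Pf) =
      pfEval n Pf (B.map (Polynomial.eval t)) := by
  have : (Polynomial.aeval t).comp (MvPolynomial.aeval (fun v : SkewIdx n => B v.1.1 v.1.2)) =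
      (MvPolynomial.aeval (fun v : SkewIdx n => (B v.1.1 v.1.2).eval t) :
        MvPolynomial (SkewIdx n) ℂ →ₐ[ℂ] ℂ) := by
    ext v
    simp [Polynomial.aeval_def, Polynomial.eval₂_eq_eval_map]
  have h := DFunLike.congr_fun this Pf
  simpa [pfEval, MvPolynomial.aeval_eq_eval, Polynomial.coe_aeval_eq_eval] using h

/-- Transformation rule for the Pfaffian under congruence: if `Pf² = det` of the
generic skew-symmetric matrix, then for any matrix `g` and any skew-symmetric matrix
`A`, one has `Pf(g * A * gᵀ) = det g * Pf(A)`. -/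
theorem pfaffian_congruence (n : ℕ) (hn : 1 ≤ n)
    (Pf : MvPolynomial (SkewIdx n) ℂ) (hPf : Pf * Pf = (genSkew n).det)
    (g A : Matrix (Fin (2 * n)) (Fin (2 * n)) ℂ) (hA : Aᵀ = -A) :
    pfEval n Pf (g * A * gᵀ) = g.det * pfEval n Pf A := by
  have key : ∀ t : ℂ, ∀ M : Matrix (Fin (2 * n)) (Fin (2 * n)) (Polynomial ℂ),
      (M * A.map Polynomial.C * Mᵀ).map (Polynomial.eval t) =
        M.map (Polynomial.eval t) * A * (M.map (Polynomial.eval t))ᵀ := by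
    intro t M
    have h1 : ∀ N : Matrix (Fin (2 * n)) (Fin (2 * n)) (Polynomial ℂ),
        N.map (Polynomial.eval t) = (Polynomial.evalRingHom t).mapMatrix N := fun N => rfl
    rw [h1, map_mul, map_mul]
    congr 1
    congr 1
    ext i j
    simp
  let M : Matrix (Fin (2 * n)) (Fin (2 * n)) (Polynomial ℂ) :=
    (1 : Matrix (Fin (2 * n)) (Fin (2 * n)) ℂ).map Polynomial.C +
      (Polynomial.X : Polynomial ℂ) • (g - 1).map Polynomial.C
  have hM : ∀ t : ℂ, M.map (Polynomial.eval t) = 1 + t • (g - 1) := by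
    intro t
    ext i j
    simp [M, -Matrix.map_one, -Matrix.map_sub]
  have hM0 : M.map (Polynomial.eval 0) = 1 := by rw [hM]; simp
  have hM1 : M.map (Polynomial.eval 1) = g := by rw [hM]; simp
  have hAC : (A.map Polynomial.C)ᵀ = -(A.map Polynomial.C) := by
    rw [← Matrix.transpose_map, hA]
    ext i j
    simp
  let B := M * A.map Polynomial.C * Mᵀ
  have hB : Bᵀ = -B := by
    simp only [B, Matrix.transpose_mul, Matrix.transpose_transpose, hAC]
    simp [Matrix.mul_assoc]
  have hBd : ∀ i, B i i = 0 := by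
    intro i
    have := congrFun (congrFun hB i) i
    exact self_eq_neg.1 this
  have hAd : ∀ i, A i i = 0 := by
    intro i
    have := congrFun (congrFun hA i) i
    exact self_eq_neg.1 this
  have hsq := pf_sq_aux n Pf hPf B hB hBd
  have hsqA : pfEval n Pf A * pfEval n Pf A = A.det := by
    simpa [pfEval, MvPolynomial.aeval_eq_eval] using pf_sq_aux n Pf hPf A hA hAd
  have hdet : ∀ t : ℂ, Polynomial.eval t M.det = (M.map (Polynomial.eval t)).det := by
    intro t
    exact RingHom.map_det (Polynomial.evalRingHom t) M
  have hdA : (A.map Polynomial.C).det = Polynomial.C A.det :=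
    (RingHom.map_det Polynomial.C A).symm
  have e : B.det = (M.det * Polynomial.C (pfEval n Pf A)) *
      (M.det * Polynomial.C (pfEval n Pf A)) := by
    simp only [B, Matrix.det_mul, Matrix.det_transpose, hdA, ← hsqA, map_mul]
    ring
  rw [e] at hsq
  have ev := fun t => pf_eval_aux n Pf t B
  have ev0 := ev 0
  have ev1 := ev 1
  simp only [B] at ev0 ev1
  rw [key, hM0, Matrix.transpose_one, Matrix.one_mul, Matrix.mul_one] at ev0
  rw [key, hM1] at ev1
  rcases mul_self_eq_mul_self_iff.1 hsq with h | h
  · simp only [B] at h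
    rw [← ev1, h, Polynomial.eval_mul, hdet, hM1, Polynomial.eval_C]
  · simp only [B] at h
    rw [h, Polynomial.eval_neg, Polynomial.eval_mul, hdet, hM0, Polynomial.eval_C,
      Matrix.det_one, one_mul] at ev0
    have z : pfEval n Pf A = 0 := self_eq_neg.1 ev0.symm
    rw [← ev1, h, z]
    simp
end

section
/- Let n ≥ 1 and let Pf be a Pfaffian polynomial for n, with Pf(A) denoting its evaluation at a skew-symmetric matrix A. Let F = {A : Matrix (Fin (2*n)) (Fin (2*n)) ℂ | Aᵀ = −A ∧ Pf(A) = 1} (the global Milnor fibre) and M = {A | Aᵀ = −A ∧ Pf(A) ≠ 0} (the complement of the Pfaffian hypersurface). For t : ℂˣ let g(t) be the diagonal matrix diag(t, 1, …, 1). Then the map h : F × ℂˣ → M given by h(A, t) = g(t) * A * g(t)ᵀ is a homeomorphism (for the subspace topologies of the product topology on matrices), and it satisfies Pf(h(A, t)) = t for all (A, t) ∈ F × ℂˣ. In particular the global Milnor fibration Pf : M → ℂ* is trivial. -/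
open Matrix MvPolynomial

/-- The diagonal matrix `diag(t, 1, …, 1)`. -/
def gdiag (n : ℕ) (t : ℂˣ) : Matrix (Fin (2 * n)) (Fin (2 * n)) ℂ :=
  Matrix.diagonal (fun i => if i.val = 0 then (t : ℂ) else 1)

/-- The diagonal matrix with an arbitrary complex entry. -/
noncomputable def dg (n : ℕ) (s : ℂ) : Matrix (Fin (2 * n)) (Fin (2 * n)) ℂ :=
  Matrix.diagonal (fun i => if i.val = 0 then s else 1)

theorem skew_conj {n : ℕ} {A : Matrix (Fin (2 * n)) (Fin (2 * n)) ℂ} (hA : Aᵀ = -A)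
    (g : Matrix (Fin (2 * n)) (Fin (2 * n)) ℂ) : (g * A * gᵀ)ᵀ = -(g * A * gᵀ) := by
  simp [Matrix.transpose_mul, hA, Matrix.mul_assoc]

theorem pf_sq {n : ℕ} {Pf : MvPolynomial (SkewIdx n) ℂ} (hPf : Pf * Pf = (genSkew n).det)
    {A : Matrix (Fin (2 * n)) (Fin (2 * n)) ℂ} (hA : Aᵀ = -A) :
    pfEval n Pf A * pfEval n Pf A = A.det := by
  unfold pfEval
  rw [← map_mul, hPf, RingHom.map_det]
  congr 1
  ext i j
  have h : ∀ i j, A j i = - A i j := fun i j => congrFun (congrFun hA i) j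
  simp only [RingHom.mapMatrix_apply, Matrix.map_apply, genSkew]
  split_ifs with h1 h2
  · exact MvPolynomial.eval_X _
  · rw [map_neg, h j i]
    exact congrArg Neg.neg (MvPolynomial.eval_X _)
  · have : i = j := le_antisymm (not_lt.mp h2) (not_lt.mp h1)
    subst this
    have := h i i
    simp only [map_zero]
    linear_combination (-1/2 : ℂ) * this

theorem det_dg {n : ℕ} (hn : 1 ≤ n) (s : ℂ) : (dg n s).det = s := by
  rw [dg, Matrix.det_diagonal, Finset.prod_eq_single (⟨0, by omega⟩ : Fin (2 * n))]
  · simp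
  · intro b _ hb
    rw [if_neg]
    intro h
    exact hb (Fin.ext h)
  · simp

theorem pf_dg {n : ℕ} (hn : 1 ≤ n) {Pf : MvPolynomial (SkewIdx n) ℂ}
    (hPf : Pf * Pf = (genSkew n).det)
    {A : Matrix (Fin (2 * n)) (Fin (2 * n)) ℂ} (hA : Aᵀ = -A) (s : ℂ) :
    pfEval n Pf (dg n s * A * (dg n s)ᵀ) = s * pfEval n Pf A := by
  let d : Fin (2 * n) → Polynomial ℂ := fun i => if i.val = 0 then Polynomial.X else 1
  let P : Polynomial ℂ := MvPolynomial.aeval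
    (fun v : SkewIdx n => d v.1.1 * Polynomial.C (A v.1.1 v.1.2) * d v.1.2) Pf
  have hP : ∀ s, P.eval s = pfEval n Pf (dg n s * A * (dg n s)ᵀ) := by
    intro s
    have hd : ∀ i, (d i).eval s = if i.val = 0 then s else 1 := by
      intro i
      simp only [d]
      split_ifs <;> simp
    have := MvPolynomial.map_aeval
      (fun v : SkewIdx n => d v.1.1 * Polynomial.C (A v.1.1 v.1.2) * d v.1.2)
      (Polynomial.evalRingHom s) Pf
    simp only [P]
    rw [← Polynomial.coe_evalRingHom, this]
    have hc : (Polynomial.evalRingHom s).comp (algebraMap ℂ (Polynomial ℂ)) = RingHom.id ℂ := by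
      ext <;> simp
    rw [hc]
    unfold pfEval
    rw [MvPolynomial.eval, MvPolynomial.coe_eval₂Hom, MvPolynomial.coe_eval₂Hom]
    congr 1
    funext v
    simp [dg, Matrix.diagonal_transpose, Matrix.mul_diagonal, Matrix.diagonal_mul, hd]
  have h1 : dg n 1 = 1 := by simp [dg]
  have hP1 : P.eval 1 = pfEval n Pf A := by rw [hP, h1]; simp
  have hsq : P * P = (Polynomial.X * Polynomial.C (pfEval n Pf A)) *
      (Polynomial.X * Polynomial.C (pfEval n Pf A)) := by
    apply Polynomial.funext
    intro r
    simp only [Polynomial.eval_mul, Polynomial.eval_X, Polynomial.eval_C]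
    rw [hP, pf_sq hPf (skew_conj hA _), Matrix.det_mul, Matrix.det_mul, Matrix.det_transpose,
      det_dg hn, ← pf_sq hPf hA]
    ring
  rw [← hP]
  rcases mul_self_eq_mul_self_iff.mp hsq with h | h
  · rw [h]; rw [Polynomial.eval_mul, Polynomial.eval_X, Polynomial.eval_C]
  · have h0 : pfEval n Pf A = 0 := by
      have h2 : P.eval 1 = - pfEval n Pf A := by rw [h]; simp
      rw [hP1] at h2
      linear_combination (1/2 : ℂ) * h2
    rw [h, h0]; simp

theorem gdiag_mul (n : ℕ) (s t : ℂˣ) : gdiag n s * gdiag n t = gdiag n (s * t) := by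
  unfold gdiag
  rw [Matrix.diagonal_mul_diagonal]
  congr 1
  funext i
  split_ifs <;> simp

theorem conj_conj (n : ℕ) (s t : ℂˣ) (h : s * t = 1) (A : Matrix (Fin (2 * n)) (Fin (2 * n)) ℂ) :
    gdiag n s * (gdiag n t * A * (gdiag n t)ᵀ) * (gdiag n s)ᵀ = A := by
  have h1 : gdiag n s * gdiag n t = 1 := by
    rw [gdiag_mul, h]; simp [gdiag]
  calc _ = (gdiag n s * gdiag n t) * A * (gdiag n s * gdiag n t)ᵀ := by
        simp only [Matrix.transpose_mul, Matrix.mul_assoc]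
    _ = A := by rw [h1]; simp

theorem cont_gdiag (n : ℕ) : Continuous (gdiag n) := by
  unfold gdiag
  refine Continuous.matrix_diagonal (continuous_pi fun i => ?_)
  split_ifs
  · exact Units.continuous_val
  · exact continuous_const

theorem cont_pfEval (n : ℕ) (Pf : MvPolynomial (SkewIdx n) ℂ) : Continuous (pfEval n Pf) := by
  unfold pfEval
  exact (MvPolynomial.continuous_eval Pf).comp
    (continuous_pi fun v => continuous_id.matrix_elem v.1.1 v.1.2)

/-- Triviality of the global Milnor fibration of the Pfaffian: the map
`(A, t) ↦ g(t) * A * g(t)ᵀ`, with `g(t) = diag(t, 1, …, 1)`, is a homeomorphism from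
`F × ℂˣ` onto the complement `M` of the Pfaffian hypersurface, where
`F = {A skew-symmetric | Pf(A) = 1}` is the global Milnor fibre, and it satisfies
`Pf(h(A, t)) = t`. -/
theorem pfaffian_milnor_fibration_trivial (n : ℕ) (hn : 1 ≤ n)
    (Pf : MvPolynomial (SkewIdx n) ℂ) (hPf : Pf * Pf = (genSkew n).det) :
    ∃ H : ({A : Matrix (Fin (2 * n)) (Fin (2 * n)) ℂ | Aᵀ = -A ∧ pfEval n Pf A = 1} × ℂˣ) ≃ₜ
        {A : Matrix (Fin (2 * n)) (Fin (2 * n)) ℂ | Aᵀ = -A ∧ pfEval n Pf A ≠ 0},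
      ∀ p, ((H p : Matrix (Fin (2 * n)) (Fin (2 * n)) ℂ)
            = gdiag n p.2 * (p.1 : Matrix (Fin (2 * n)) (Fin (2 * n)) ℂ) * (gdiag n p.2)ᵀ)
        ∧ pfEval n Pf (H p : Matrix (Fin (2 * n)) (Fin (2 * n)) ℂ) = (p.2 : ℂ) := by
  have key : ∀ (A : Matrix (Fin (2 * n)) (Fin (2 * n)) ℂ) (t : ℂˣ), Aᵀ = -A →
      pfEval n Pf (gdiag n t * A * (gdiag n t)ᵀ) = t * pfEval n Pf A :=
    fun A t hA => pf_dg hn hPf hA (t : ℂ)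
  refine ⟨{ toFun := fun p => ⟨gdiag n p.2 * p.1.1 * (gdiag n p.2)ᵀ, skew_conj p.1.2.1 _, ?_⟩
            invFun := fun B => (⟨gdiag n (Units.mk0 _ B.2.2)⁻¹ * B.1 *
              (gdiag n (Units.mk0 _ B.2.2)⁻¹)ᵀ, skew_conj B.2.1 _, ?_⟩, Units.mk0 _ B.2.2)
            left_inv := ?_
            right_inv := ?_
            continuous_toFun := ?_
            continuous_invFun := ?_ }, ?_⟩
  · rw [key _ _ p.1.2.1, p.1.2.2]; simp
  · rw [key _ _ B.2.1]
    simp only [Units.val_inv_eq_inv_val, Units.val_mk0]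
    exact inv_mul_cancel₀ B.2.2
  · rintro ⟨⟨A, hA, hA1⟩, t⟩
    have ht : ∀ h, Units.mk0 (pfEval n Pf (gdiag n t * A * (gdiag n t)ᵀ)) h = t := by
      intro h
      ext
      rw [Units.val_mk0, key _ _ hA, hA1, mul_one]
    have hne : pfEval n Pf (gdiag n t * A * (gdiag n t)ᵀ) ≠ 0 := by
      rw [key _ _ hA, hA1]; simp
    refine Prod.ext (Subtype.ext ?_) (ht hne)
    simp only [ht]
    exact conj_conj n _ _ (by simp) A
  · rintro ⟨B, hB, hB1⟩
    refine Subtype.ext ?_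
    exact conj_conj n _ _ (by simp) B
  · refine Continuous.subtype_mk ?_ _
    have h1 := (cont_gdiag n).comp (continuous_snd (X := {A : Matrix (Fin (2 * n)) (Fin (2 * n)) ℂ | Aᵀ = -A ∧ pfEval n Pf A = 1}) (Y := ℂˣ))
    exact (h1.matrix_mul (continuous_subtype_val.comp continuous_fst)).matrix_mul
      h1.matrix_transpose
  · have hu : Continuous (fun B : {A : Matrix (Fin (2 * n)) (Fin (2 * n)) ℂ |
        Aᵀ = -A ∧ pfEval n Pf A ≠ 0} => Units.mk0 (pfEval n Pf B.1) B.2.2) := by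
      rw [Units.isEmbedding_val₀.continuous_iff]
      exact (cont_pfEval n Pf).comp continuous_subtype_val
    refine Continuous.prodMk (Continuous.subtype_mk ?_ _) hu
    have h1 := (cont_gdiag n).comp hu.inv
    exact (h1.matrix_mul continuous_subtype_val).matrix_mul h1.matrix_transpose
  · intro p
    refine ⟨rfl, ?_⟩
    change pfEval n Pf (gdiag n p.2 * p.1.1 * (gdiag n p.2)ᵀ) = _
    rw [key _ _ p.1.2.1, p.1.2.2, mul_one]
end

section
/- Let n ≥ 1 and let Pf be a Pfaffian polynomial for n. The global Milnor fibre F = {A : Matrix (Fin (2*n)) (Fin (2*n)) ℂ | Aᵀ = −A ∧ Pf(A) = 1}, with its subspace topology, is 4-connected: F is nonempty and path-connected, and for every basepoint x ∈ F and every k with 1 ≤ k ≤ 4 the homotopy group π_k(F, x) is trivial. -/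
open Matrix MvPolynomial

noncomputable def bord {m : ℕ} (v : Fin m → ℂ) (B : Matrix (Fin m) (Fin m) ℂ) :
    Matrix (Fin (m+1)) (Fin (m+1)) ℂ :=
  Matrix.of (Fin.cons (Fin.cons 0 v) (fun i => Fin.cons (- v i) (B i)))

lemma bord_mulVec {m : ℕ} (v : Fin m → ℂ) (B : Matrix (Fin m) (Fin m) ℂ) (x : Fin (m+1) → ℂ) :
    bord v B *ᵥ x = Fin.cons (v ⬝ᵥ (fun i => x i.succ))
      (fun i => - v i * x 0 + (B *ᵥ (fun i => x i.succ)) i) := by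
  funext i
  refine Fin.cases ?_ (fun i => ?_) i
  · simp [bord, Matrix.mulVec, dotProduct, Fin.sum_univ_succ]
  · simp [bord, Matrix.mulVec, dotProduct, Fin.sum_univ_succ]

lemma bord_skew {m : ℕ} (v : Fin m → ℂ) {B : Matrix (Fin m) (Fin m) ℂ} (hB : Bᵀ = -B) :
    (bord v B)ᵀ = - bord v B := by
  ext i j
  refine Fin.cases ?_ (fun i => ?_) i <;> refine Fin.cases ?_ (fun j => ?_) j
  · simp [bord]
  · simp [bord]
  · simp [bord]
  · simpa [bord] using congrFun (congrFun hB i) j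

lemma bord_det_smul {m : ℕ} (s : ℂ) (v : Fin m → ℂ) (B : Matrix (Fin m) (Fin m) ℂ) :
    (bord (s • v) B).det = s ^ 2 * (bord v B).det := by
  have : bord (s • v) B = diagonal (Fin.cons s (fun _ => 1)) * bord v B *
      diagonal (Fin.cons s (fun _ => 1)) := by
    ext i j
    rw [Matrix.mul_diagonal, Matrix.diagonal_mul]
    refine Fin.cases ?_ (fun i => ?_) i <;> refine Fin.cases ?_ (fun j => ?_) j <;>
      simp [bord, mul_comm]
  rw [this, det_mul, det_mul, det_diagonal, Fin.prod_univ_succ]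
  simp; ring

lemma odd_skew_det {m : ℕ} (hm : Odd m) {B : Matrix (Fin m) (Fin m) ℂ} (hB : Bᵀ = -B) :
    B.det = 0 := by
  have h := congrArg Matrix.det hB
  rw [det_transpose, det_neg, Fintype.card_fin, hm.neg_one_pow] at h
  have : (2:ℂ) * B.det = 0 := by linear_combination h
  simpa using this

lemma skew_dot {m : ℕ} {B : Matrix (Fin m) (Fin m) ℂ} (hB : Bᵀ = -B) {z : Fin m → ℂ}
    (hz : B *ᵥ z = 0) (x : Fin m → ℂ) : z ⬝ᵥ (B *ᵥ x) = 0 := by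
  rw [dotProduct_mulVec, ← mulVec_transpose, hB, neg_mulVec, hz]; simp

open ComplexOrder in
lemma star_dot_ne {m : ℕ} {z : Fin m → ℂ} (hz : z ≠ 0) : star z ⬝ᵥ z ≠ 0 := by
  intro h; exact hz (dotProduct_star_self_eq_zero.1 h)

lemma star_dot_symm {m : ℕ} {z y : Fin m → ℂ} (h : star z ⬝ᵥ y = 0) : star y ⬝ᵥ z = 0 := by
  have := congrArg star h
  rw [star_dotProduct] at this
  simpa using this

lemma kernel_three {m : ℕ} (hm : Odd m) {B : Matrix (Fin m) (Fin m) ℂ} (hB : Bᵀ = -B)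
    (h : ∀ v, (bord v B).det = 0) :
    ∃ z y x : Fin m → ℂ, z ≠ 0 ∧ y ≠ 0 ∧ x ≠ 0 ∧ B *ᵥ z = 0 ∧ B *ᵥ y = 0 ∧ B *ᵥ x = 0 ∧
      star z ⬝ᵥ y = 0 ∧ star z ⬝ᵥ x = 0 ∧ star y ⬝ᵥ x = 0 := by
  obtain ⟨z, hz0, hz⟩ := Matrix.exists_mulVec_eq_zero_iff.2 (odd_skew_det hm hB)
  obtain ⟨w, hw0, hw⟩ := Matrix.exists_mulVec_eq_zero_iff.2 (h (star z))
  rw [bord_mulVec] at hw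
  set y : Fin m → ℂ := fun i => w i.succ with hy
  have e0 : star z ⬝ᵥ y = 0 := by simpa using congrFun hw 0
  have e1 : B *ᵥ y = w 0 • star z := by
    funext i
    have := congrFun hw i.succ
    simp at this
    simp; linear_combination this
  have e2 := skew_dot hB hz y
  rw [e1, dotProduct_smul, dotProduct_comm] at e2
  have w0 : w 0 = 0 := by
    rcases smul_eq_zero.1 e2 with h | h
    · exact h
    · exact absurd h (star_dot_ne hz0)
  have hBy : B *ᵥ y = 0 := by rw [e1, w0, zero_smul]
  have hy0 : y ≠ 0 := by
    intro h0; apply hw0; funext i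
    refine Fin.cases w0 (fun i => ?_) i
    exact congrFun h0 i
  have e0' := star_dot_symm e0
  have hB' : (B + vecMulVec (star z) (star y) - vecMulVec (star y) (star z))ᵀ =
      -(B + vecMulVec (star z) (star y) - vecMulVec (star y) (star z)) := by
    rw [transpose_sub, transpose_add, hB, transpose_vecMulVec, transpose_vecMulVec]
    abel
  obtain ⟨x, hx0, hx⟩ := Matrix.exists_mulVec_eq_zero_iff.2 (odd_skew_det hm hB')
  rw [sub_mulVec, add_mulVec, vecMulVec_mulVec, vecMulVec_mulVec] at hx
  have f1 := congrArg (fun u => z ⬝ᵥ u) hx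
  have f2 := congrArg (fun u => y ⬝ᵥ u) hx
  simp only [dotProduct_sub, dotProduct_add, skew_dot hB hz, skew_dot hB hBy, dotProduct_zero,
    zero_add] at f1 f2
  have hzz := star_dot_ne hz0
  have hyy := star_dot_ne hy0
  rw [dotProduct_comm] at e0 e0' hzz hyy
  simp [dotProduct_smul, e0, e0', hzz, hyy] at f1 f2
  refine ⟨z, y, x, hz0, hy0, hx0, hz, hBy, ?_, by rwa [dotProduct_comm], f2, f1⟩
  rw [f1, f2] at hx
  simpa using hx

lemma exists_triangular {m : ℕ} {N : Submodule ℂ (Fin m → ℂ)} {z y x : Fin m → ℂ}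
    (hz : z ∈ N) (hy : y ∈ N) (hx : x ∈ N) (hz0 : z ≠ 0) (hy0 : y ≠ 0) (hx0 : x ≠ 0)
    (hzy : star z ⬝ᵥ y = 0) (hzx : star z ⬝ᵥ x = 0) (hyx : star y ⬝ᵥ x = 0) :
    ∃ T : Finset (Fin m), T.card = 3 ∧ ∃ n : Fin m → Fin m → ℂ, ∀ t ∈ T, n t ∈ N ∧
      ∀ t' ∈ T, n t t' = if t' = t then 1 else 0 := by
  have nz : ∀ {w : Fin m → ℂ}, w ≠ 0 → ∃ i, w i ≠ 0 := fun h => Function.ne_iff.1 h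
  obtain ⟨i, hi⟩ := nz hz0
  -- normalise z
  set p := (z i)⁻¹ • z with hp
  have pN : p ∈ N := N.smul_mem _ hz
  have pi : p i = 1 := by simp [hp, hi]
  set y1 := y - y i • p with hy1
  have y1N : y1 ∈ N := N.sub_mem hy (N.smul_mem _ pN)
  have y1i : y1 i = 0 := by simp [hy1, pi]
  have y1y : star y ⬝ᵥ y1 = star y ⬝ᵥ y := by
    simp [hy1, hp, dotProduct_sub, dotProduct_smul, star_dot_symm hzy]
  have y10 : y1 ≠ 0 := by
    intro h; rw [h, dotProduct_zero] at y1y; exact star_dot_ne hy0 y1y.symm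
  obtain ⟨j, hj⟩ := nz y10
  set q := (y1 j)⁻¹ • y1 with hq
  have qN : q ∈ N := N.smul_mem _ y1N
  have qj : q j = 1 := by simp [hq, hj]
  have qi : q i = 0 := by simp [hq, y1i]
  set x1 := x - x i • p with hx1
  set x2 := x1 - x1 j • q with hx2
  have x2N : x2 ∈ N := N.sub_mem (N.sub_mem hx (N.smul_mem _ pN)) (N.smul_mem _ qN)
  have x2i : x2 i = 0 := by simp [hx2, hx1, pi, qi]
  have x2j : x2 j = 0 := by simp [hx2, qj]
  have x2x : star x ⬝ᵥ x2 = star x ⬝ᵥ x := by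
    simp [hx2, hx1, hq, hy1, hp, dotProduct_sub, dotProduct_smul, star_dot_symm hzx,
      star_dot_symm hyx]
  have x20 : x2 ≠ 0 := by
    intro h; rw [h, dotProduct_zero] at x2x; exact star_dot_ne hx0 x2x.symm
  obtain ⟨k, hk⟩ := nz x20
  set r := (x2 k)⁻¹ • x2 with hr
  have rN : r ∈ N := N.smul_mem _ x2N
  have rk : r k = 1 := by simp [hr, hk]
  have ri : r i = 0 := by simp [hr, x2i]
  have rj : r j = 0 := by simp [hr, x2j]
  have hij : i ≠ j := by rintro rfl; simp [qi] at qj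
  have hik : i ≠ k := by rintro rfl; simp [ri] at rk
  have hjk : j ≠ k := by rintro rfl; simp [rj] at rk
  set q' := q - q k • r with hq'
  have q'N : q' ∈ N := N.sub_mem qN (N.smul_mem _ rN)
  set p' := p - p j • q' - p k • r with hp'
  have p'N : p' ∈ N := N.sub_mem (N.sub_mem pN (N.smul_mem _ q'N)) (N.smul_mem _ rN)
  refine ⟨{i, j, k}, Finset.card_eq_three.2 ⟨i, j, k, hij, hik, hjk, rfl⟩,
    fun t => if t = i then p' else if t = j then q' else r, ?_⟩
  have q'i : q' i = 0 := by simp [hq', qi, ri]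
  have q'j : q' j = 1 := by simp [hq', qj, rj]
  have q'k : q' k = 0 := by simp [hq', rk]
  have p'i : p' i = 1 := by simp [hp', pi, q'i, ri]
  have p'j : p' j = 0 := by simp [hp', q'j, rj]
  have p'k : p' k = 0 := by simp [hp', q'k, rk]
  clear_value p q r p' q'
  intro t ht
  simp only [Finset.mem_insert, Finset.mem_singleton] at ht
  rcases ht with rfl | rfl | rfl
  · simp [p'N, p'i, p'j, p'k, hij.symm, hik.symm]
  · simp [hij.symm, q'N, q'i, q'j, q'k, hij, hjk.symm]
  · simp [hik.symm, hjk.symm, rN, ri, rj, rk, hik, hjk]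

/-- ordered pairs -/
abbrev Prs (m : ℕ) : Type := {p : Fin m × Fin m // p.1 < p.2}

/-- skew matrix from its upper entries -/
noncomputable def mk {m : ℕ} (β : Prs m → ℂ) : Matrix (Fin m) (Fin m) ℂ :=
  Matrix.of fun i j => if h : i < j then β ⟨(i, j), h⟩
    else if h' : j < i then -(β ⟨(j, i), h'⟩) else 0

lemma mk_skew {m : ℕ} (β : Prs m → ℂ) : (mk β)ᵀ = - mk β := by
  ext i j
  rcases lt_trichotomy i j with h | h | h
  · simp [mk, h, h.not_gt]
  · subst h; simp [mk]
  · simp [mk, h, h.not_gt]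

lemma skew_apply {m : ℕ} {B : Matrix (Fin m) (Fin m) ℂ} (hB : Bᵀ = -B) (i j) :
    B i j = - B j i := by
  have := congrFun (congrFun hB j) i
  simpa using this

lemma mk_of_skew {m : ℕ} {B : Matrix (Fin m) (Fin m) ℂ} (hB : Bᵀ = -B) :
    mk (fun p : Prs m => B p.1.1 p.1.2) = B := by
  ext i j
  rcases lt_trichotomy i j with h | h | h
  · simp [mk, h]
  · subst h
    have := skew_apply hB i i
    have : B i i = 0 := by
      have h2 : (2:ℂ) * B i i = 0 := by linear_combination this
      simpa using h2
    simp [mk, this]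
  · simp [mk, h, h.not_gt, skew_apply hB i j]

/-- pairs not contained in `T` -/
abbrev PrsT {m : ℕ} (T : Finset (Fin m)) : Type := {p : Prs m // ¬ (p.1.1 ∈ T ∧ p.1.2 ∈ T)}

noncomputable def extT {m : ℕ} (T : Finset (Fin m)) (ξ : PrsT T → ℂ) : Prs m → ℂ :=
  fun p => if h : ¬ (p.1.1 ∈ T ∧ p.1.2 ∈ T) then ξ ⟨p, h⟩ else 0

noncomputable def LTm {m : ℕ} (T : Finset (Fin m)) (M : Matrix (Fin m) (Fin m) ℂ) :
    Matrix (Fin m) (Fin m) ℂ :=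
  Matrix.of fun i j => if j ∈ T then 0 else if i ∈ T then M i j else if i = j then 1 else 0

noncomputable def zT {m : ℕ} (T : Finset (Fin m)) (ξ : PrsT T → ℂ) : Prs m → ℂ :=
  fun p => ∑ s', (∑ s, LTm T (mk (extT T ξ)) p.1.1 s * mk (extT T ξ) s s') *
    LTm T (mk (extT T ξ)) p.1.2 s'

lemma contDiff_mk {m : ℕ} {E : Type*} [NormedAddCommGroup E] [NormedSpace ℝ E]
    {f : E → Prs m → ℂ} (hf : ContDiff ℝ 1 f) (i j : Fin m) :
    ContDiff ℝ 1 (fun e => mk (f e) i j) := by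
  simp only [mk, Matrix.of_apply]
  split_ifs
  · exact contDiff_pi.1 hf _
  · exact (contDiff_pi.1 hf _).neg
  · exact contDiff_const

lemma contDiff_zT {m : ℕ} (T : Finset (Fin m)) : ContDiff ℝ 1 (zT T) := by
  have h1 : ContDiff ℝ 1 (extT T) := by
    refine contDiff_pi.2 fun p => ?_
    simp only [extT]
    split_ifs
    · exact contDiff_const
    · exact contDiff_apply ℝ ℂ _
  have h2 := fun i j => contDiff_mk h1 i j
  have h3 : ∀ i j, ContDiff ℝ 1 (fun ξ => LTm T (mk (extT T ξ)) i j) := by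
    intro i j
    simp only [LTm, Matrix.of_apply]
    split_ifs
    · exact contDiff_const
    · exact h2 i j
    · exact contDiff_const
    · exact contDiff_const
  refine contDiff_pi.2 fun p => ?_
  exact ContDiff.sum fun s' _ => (ContDiff.sum fun s _ => (h3 _ _).mul (h2 _ _)).mul (h3 _ _)

lemma mem_range_zT {m : ℕ} (T : Finset (Fin m)) (β : Prs m → ℂ)
    (n : Fin m → Fin m → ℂ) (hn : ∀ t ∈ T, mk β *ᵥ n t = 0 ∧
      ∀ t' ∈ T, n t t' = if t' = t then 1 else 0) : β ∈ Set.range (zT T) := by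
  classical
  set B := mk β with hBdef
  have hB : Bᵀ = -B := mk_skew β
  let ξ : PrsT T → ℂ := fun p =>
    if p.1.1.1 ∈ T then - n p.1.1.1 p.1.1.2 else if p.1.1.2 ∈ T then n p.1.1.2 p.1.1.1 else β p.1
  refine ⟨ξ, ?_⟩
  set M := mk (extT T ξ) with hM
  have M1 : ∀ i j, i ∉ T → j ∉ T → M i j = B i j := by
    intro i j hi hj
    simp only [hM, hBdef, mk, Matrix.of_apply, extT, ξ]
    split_ifs <;> simp_all
  have M2 : ∀ i j, i ∈ T → j ∉ T → M i j = - n i j := by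
    intro i j hi hj
    have : i ≠ j := by rintro rfl; exact hj hi
    simp only [hM, mk, Matrix.of_apply, extT, ξ]
    split_ifs <;> simp_all
    · omega
  have key : ∀ i j, ∑ s, B i s * LTm T M j s = B i j := by
    intro i j
    by_cases hj : j ∈ T
    · have e := congrFun (hn j hj).1 i
      simp only [Matrix.mulVec, dotProduct, Pi.zero_apply] at e
      have : ∑ s, (B i s * LTm T M j s + B i s * n j s) = ∑ s, if s = j then B i s else 0 := by
        refine Finset.sum_congr rfl fun s _ => ?_
        by_cases hs : s ∈ T
        · rw [(hn j hj).2 s hs]; simp [LTm, hs]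
        · have : s ≠ j := by rintro rfl; exact hs hj
          simp [LTm, hs, hj, M2 j s hj hs, this]
      rw [Finset.sum_add_distrib, e] at this
      simpa using this
    · have : ∀ s, B i s * LTm T M j s = if j = s then B i s else 0 := by
        intro s
        by_cases hs : s ∈ T
        · have : j ≠ s := by rintro rfl; exact hj hs
          simp [LTm, hs, this]
        · simp [LTm, hs, hj]
      simp [this]
  have key2 : ∀ i j, ∑ s, LTm T M i s * B s j = B i j := by
    intro i j
    rw [skew_apply hB i j, ← key j i, ← Finset.sum_neg_distrib]
    refine Finset.sum_congr rfl fun s _ => ?_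
    rw [skew_apply hB s j]; ring
  funext p
  have : β p = B p.1.1 p.1.2 := by simp [hBdef, mk, p.2]
  rw [this, ← key]
  simp only [zT]
  refine Finset.sum_congr rfl fun s' _ => ?_
  by_cases hs' : s' ∈ T
  · simp [LTm, hs']
  · congr 1
    rw [← key2]
    refine Finset.sum_congr rfl fun s _ => ?_
    by_cases hs : s ∈ T
    · simp [LTm, hs]
    · rw [← hM, M1 s s' hs hs']

lemma card_PrsT {m : ℕ} (T : Finset (Fin m)) (hT : T.card = 3) :
    Fintype.card (PrsT T) + 3 ≤ Fintype.card (Prs m) := by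
  have h1 : Fintype.card (PrsT T) =
      Fintype.card (Prs m) - Fintype.card {p : Prs m // p.1.1 ∈ T ∧ p.1.2 ∈ T} :=
    Fintype.card_subtype_compl _
  have h2 : Fintype.card {p : Prs m // p.1.1 ∈ T ∧ p.1.2 ∈ T} ≤ Fintype.card (Prs m) :=
    Fintype.card_subtype_le _
  have h3 : Fintype.card (Prs 3) ≤ Fintype.card {p : Prs m // p.1.1 ∈ T ∧ p.1.2 ∈ T} := by
    refine Fintype.card_le_of_injective
      (fun p => ⟨⟨(T.orderEmbOfFin hT p.1.1, T.orderEmbOfFin hT p.1.2), by simpa using p.2⟩,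
        by simp⟩) ?_
    intro p p' h
    simp at h
    ext <;> simp [h]
  have h4 : Fintype.card (Prs 3) = 3 := by decide
  omega

lemma kernel_range {m : ℕ} (hm : Odd m) (β : Prs m → ℂ)
    (h : ∀ v, (bord v (mk β)).det = 0) :
    ∃ T : {T : Finset (Fin m) // T.card = 3}, β ∈ Set.range (zT T.1) := by
  obtain ⟨z, y, x, hz0, hy0, hx0, hz, hy, hx, h1, h2, h3⟩ := kernel_three hm (mk_skew β) h
  obtain ⟨T, hT, n, hn⟩ := exists_triangular (N := LinearMap.ker (mk β).mulVecLin)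
    (by simpa using hz) (by simpa using hy) (by simpa using hx) hz0 hy0 hx0 h1 h2 h3
  exact ⟨⟨T, hT⟩, mem_range_zT T β n fun t ht => ⟨by simpa using (hn t ht).1, (hn t ht).2⟩⟩

lemma exists_generic {m k : ℕ} (hk : k ≤ 4) (g : (Fin (k+1) → ℝ) → Prs m → ℂ)
    (hg : ContDiff ℝ 1 g) :
    ∃ b : Prs m → ℂ, ∀ (T : {T : Finset (Fin m) // T.card = 3}) (y : Fin (k+1) → ℝ) (i : Fin (k+1)),
      (y i = 0 ∨ y i = 1) → ∀ t : ℝ, t ≠ 0 → (1 - t) • g y + t • b ∉ Set.range (zT T.1) := by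
  rcases isEmpty_or_nonempty {T : Finset (Fin m) // T.card = 3} with hE | hE
  · exact ⟨0, fun T => hE.elim T⟩
  let Φ : {T : Finset (Fin m) // T.card = 3} × Fin (k+1) × Bool → Set (Prs m → ℂ) := fun a =>
    Set.range (fun e : (PrsT a.1.1 → ℂ) × (Fin (k+1) → ℝ) => e.2 a.2.1 • zT a.1.1 e.1 +
      (1 - e.2 a.2.1) • g (Function.update e.2 a.2.1 (if a.2.2 then 1 else 0)))
  have hD : Module.finrank ℝ (Prs m → ℂ) = 2 * Fintype.card (Prs m) := by
    rw [Module.finrank_pi_fintype]; simp [Complex.finrank_real_complex, mul_comm]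
  have hΦ : ∀ a, dimH (Φ a) ≤ ((Module.finrank ℝ (Prs m → ℂ) - 1 : ℕ) : ENNReal) := by
    intro a
    have c1 : ContDiff ℝ 1 (fun e : (PrsT a.1.1 → ℂ) × (Fin (k+1) → ℝ) =>
      e.2 a.2.1 • zT a.1.1 e.1 +
      (1 - e.2 a.2.1) • g (Function.update e.2 a.2.1 (if a.2.2 then 1 else 0))) := by
      have c2 : ContDiff ℝ 1 (fun e : (PrsT a.1.1 → ℂ) × (Fin (k+1) → ℝ) => e.2 a.2.1) :=
        (contDiff_apply ℝ ℝ _).comp contDiff_snd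
      refine (c2.smul ((contDiff_zT _).comp contDiff_fst)).add
        ((contDiff_const.sub c2).smul (hg.comp ?_))
      refine contDiff_pi.2 fun j => ?_
      by_cases hj : j = a.2.1
      · subst hj; simp only [Function.update_self]; exact contDiff_const
      · simp only [Function.update_of_ne hj]
        exact (contDiff_apply ℝ ℝ _).comp contDiff_snd
    refine c1.dimH_range_le.trans ?_
    norm_cast
    rw [hD, Module.finrank_prod, Module.finrank_pi_fintype]
    have := card_PrsT a.1.1 a.1.2
    simp only [Complex.finrank_real_complex, Finset.sum_const, Finset.card_univ, smul_eq_mul,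
      Module.finrank_fin_fun]
    omega
  have hne : (⋃ a, Φ a) ≠ Set.univ := by
    intro h
    have h1 : dimH (⋃ a, Φ a) ≤ ((Module.finrank ℝ (Prs m → ℂ) - 1 : ℕ) : ENNReal) := by
      rw [dimH_iUnion]; exact iSup_le hΦ
    rw [h, Real.dimH_univ_eq_finrank] at h1
    have h2 : Module.finrank ℝ (Prs m → ℂ) ≤ Module.finrank ℝ (Prs m → ℂ) - 1 := by
      exact_mod_cast h1
    obtain ⟨T⟩ := hE
    have := card_PrsT T.1 T.2
    omega
  obtain ⟨b, hb⟩ := (Set.ne_univ_iff_exists_notMem _).1 hne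
  refine ⟨b, ?_⟩
  rintro T y i hi t ht ⟨ξ, hξ⟩
  apply hb
  refine Set.mem_iUnion.2 ⟨(T, i, decide (y i = 1)), (ξ, Function.update y i t⁻¹), ?_⟩
  have hu : Function.update (Function.update y i t⁻¹) i (if decide (y i = 1) then 1 else 0) = y := by
    rw [Function.update_idem]
    rcases hi with h | h
    · have : (if decide (y i = 1) then (1:ℝ) else 0) = y i := by simp [h]
      rw [this, Function.update_eq_self]
    · have : (if decide (y i = 1) then (1:ℝ) else 0) = y i := by simp [h]
      rw [this, Function.update_eq_self]
  simp only [hu, Function.update_self, hξ]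
  rw [smul_add, smul_smul, smul_smul, inv_mul_cancel₀ ht, one_smul, add_right_comm, ← add_smul]
  have : t⁻¹ * (1 - t) + (1 - t⁻¹) = 0 := by field_simp; ring
  rw [this]; simp

open scoped unitInterval in
abbrev Bd (k : ℕ) : Type := {y : Fin (k+1) → I // y ∈ Cube.boundary (Fin (k+1))}

lemma isClosed_cube_boundary (k : ℕ) : IsClosed (Cube.boundary (Fin k)) := by
  have : Cube.boundary (Fin k) = ⋃ i : Fin k, {y | y i = 0 ∨ y i = 1} := by
    ext y; simp [Cube.boundary]
  rw [this]
  refine isClosed_iUnion_of_finite fun i => ?_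
  exact (isClosed_eq (continuous_apply i) continuous_const).union
    (isClosed_eq (continuous_apply i) continuous_const)

instance (k : ℕ) : CompactSpace (Bd k) :=
  isCompact_iff_compactSpace.1 (isClosed_cube_boundary (k+1)).isCompact

noncomputable def crd {k : ℕ} (y : Bd k) : Fin (k+1) → ℝ := fun i => (y.1 i : ℝ)

lemma continuous_crd (k : ℕ) : Continuous (crd : Bd k → _) := by
  exact continuous_pi fun i => continuous_subtype_val.comp
    ((continuous_apply i).comp continuous_subtype_val)

lemma approx_real {k : ℕ} (f : Bd k → ℝ) (hf : Continuous f) (ε : ℝ) (hε : 0 < ε) :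
    ∃ g : (Fin (k+1) → ℝ) → ℝ, ContDiff ℝ 1 g ∧ ∀ y, ‖g (crd y) - f y‖ < ε := by
  let A : Subalgebra ℝ C(Bd k, ℝ) :=
    { carrier := {h | ∃ g : (Fin (k+1) → ℝ) → ℝ, ContDiff ℝ 1 g ∧ ∀ y, h y = g (crd y)}
      mul_mem' := by
        rintro a b ⟨g, hg, h⟩ ⟨g', hg', h'⟩
        exact ⟨fun x => g x * g' x, hg.mul hg', fun y => by simp [h, h']⟩
      add_mem' := by
        rintro a b ⟨g, hg, h⟩ ⟨g', hg', h'⟩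
        exact ⟨fun x => g x + g' x, hg.add hg', fun y => by simp [h, h']⟩
      algebraMap_mem' := fun r => ⟨fun _ => r, contDiff_const, fun y => rfl⟩ }
  have hA : A.SeparatesPoints := by
    intro y y' hne
    have : ∃ i, y.1 i ≠ y'.1 i := by
      by_contra! h
      exact hne (Subtype.ext (funext h))
    obtain ⟨i, hi⟩ := this
    refine ⟨fun y => crd y i, ⟨⟨fun y => crd y i, (continuous_apply i).comp (continuous_crd k)⟩,
      ⟨fun x => x i, contDiff_apply ℝ ℝ i, fun y => rfl⟩, rfl⟩, ?_⟩
    intro h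
    exact hi (Subtype.ext h)
  obtain ⟨⟨g, g', hg', h⟩, hg⟩ :=
    ContinuousMap.exists_mem_subalgebra_near_continuous_of_separatesPoints A hA f hf ε hε
  exact ⟨g', hg', fun y => by rw [← h]; exact hg y⟩

lemma approx {k m : ℕ} (f : Bd k → Prs m → ℂ) (hf : Continuous f) (ε : ℝ) (hε : 0 < ε) :
    ∃ g : (Fin (k+1) → ℝ) → Prs m → ℂ, ContDiff ℝ 1 g ∧ ∀ y, ‖g (crd y) - f y‖ < ε := by
  have hf' := continuous_pi_iff.1 hf
  have h1 := fun p => approx_real (fun y => (f y p).re) (Complex.continuous_re.comp (hf' p))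
    (ε/2) (by positivity)
  have h2 := fun p => approx_real (fun y => (f y p).im) (Complex.continuous_im.comp (hf' p))
    (ε/2) (by positivity)
  choose a ha ha' using h1
  choose b hb hb' using h2
  refine ⟨fun x p => (a p x : ℂ) + (b p x : ℂ) * Complex.I, ?_, ?_⟩
  · refine contDiff_pi.2 fun p => ?_
    exact (Complex.ofRealCLM.contDiff.comp (ha p)).add
      ((Complex.ofRealCLM.contDiff.comp (hb p)).mul contDiff_const)
  · intro y
    rw [pi_norm_lt_iff hε]
    intro p
    have h1 := ha' p y
    have h2 := hb' p y
    rw [Real.norm_eq_abs] at h1 h2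
    refine (Complex.norm_le_abs_re_add_abs_im _).trans_lt ?_
    simp
    linarith

lemma linear_of_sq {m : ℕ} (Q : (Fin m → ℂ) → ℂ) (hd : Differentiable ℂ Q)
    (hsq : ∀ (s : ℂ) v, Q (s • v) ^ 2 = s ^ 2 * Q v ^ 2) (v : Fin m → ℂ) :
    Q v = ∑ j, v j * Q (Pi.single j 1) := by
  have hom : ∀ (s : ℂ) v, Q (s • v) = s * Q v := by
    intro s v
    have hc : Continuous (fun s : ℂ => Q (s • v)) := hd.continuous.comp (by fun_prop)
    rcases eq_or_ne s 0 with rfl | hs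
    · have := hsq 0 v
      simpa using this
    rcases eq_or_ne (Q v) 0 with h | h
    · have := hsq s v
      simpa [h] using this
    · have hconn : IsPreconnected ({0}ᶜ : Set ℂ) :=
        (isConnected_compl_singleton_of_one_lt_rank (by simp) 0).isPreconnected
      refine hconn.eq_of_sq_eq (f := fun s : ℂ => Q (s • v)) (g := fun s => s * Q v)
        hc.continuousOn (by fun_prop) ?_ ?_ (y := 1) (by simp) (by simp) hs
      · intro x hx
        simp [hsq, mul_pow]
      · intro x hx
        exact mul_ne_zero hx h
  have lin : ∀ v, Q v = fderiv ℂ Q 0 v := by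
    intro v
    have h1 : HasDerivAt (fun s : ℂ => s * Q v) (1 * Q v) 0 := (hasDerivAt_id 0).mul_const _
    have h2 : HasDerivAt (fun s : ℂ => s • v) ((1:ℂ) • v) 0 := (hasDerivAt_id 0).smul_const _
    have h3 : HasFDerivAt Q (fderiv ℂ Q 0) ((0:ℂ) • v) := by
      rw [zero_smul]; exact (hd 0).hasFDerivAt
    have h4 := h3.comp_hasDerivAt (0:ℂ) h2
    have h5 : (Q ∘ fun s : ℂ => s • v) = fun s => s * Q v := funext fun s => hom s v
    rw [h5] at h4
    simpa using h1.unique h4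
  rw [lin v]
  conv_lhs => rw [pi_eq_sum_univ' v]
  rw [map_sum]
  refine Finset.sum_congr rfl fun j _ => ?_
  rw [map_smul, smul_eq_mul, lin (Pi.single j 1)]

section main
variable {m : ℕ} (q : Matrix (Fin (m+1)) (Fin (m+1)) ℂ → ℂ)

abbrev FF : Set (Matrix (Fin (m+1)) (Fin (m+1)) ℂ) := {A | Aᵀ = -A ∧ q A = 1}

noncomputable def QQ (v : Fin m → ℂ) (β : Prs m → ℂ) : ℂ := q (bord v (mk β))

noncomputable def cc (β : Prs m → ℂ) : Fin m → ℂ := fun j => QQ q (Pi.single j 1) β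

lemma continuous_bord_mk : Continuous (fun x : (Fin m → ℂ) × (Prs m → ℂ) => bord x.1 (mk x.2)) := by
  refine continuous_matrix fun i j => ?_
  refine Fin.cases ?_ (fun i => ?_) i <;> refine Fin.cases ?_ (fun j => ?_) j
  · simp only [bord, Matrix.of_apply, Fin.cons_zero]; fun_prop
  · simp only [bord, Matrix.of_apply, Fin.cons_zero, Fin.cons_succ]; fun_prop
  · simp only [bord, Matrix.of_apply, Fin.cons_zero, Fin.cons_succ]; fun_prop
  · simp only [bord, mk, Matrix.of_apply, Fin.cons_succ]
    split_ifs <;> fun_prop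

variable (hq : Continuous q)
  (hd : ∀ β : Prs m → ℂ, Differentiable ℂ (fun v : Fin m → ℂ => q (bord v (mk β))))
  (hsq : ∀ A, Aᵀ = -A → q A ^ 2 = A.det)

include hq in
lemma continuous_QQ : Continuous (fun x : (Fin m → ℂ) × (Prs m → ℂ) => QQ q x.1 x.2) :=
  hq.comp continuous_bord_mk

include hd hsq in
lemma QQ_eq (v : Fin m → ℂ) (β : Prs m → ℂ) : QQ q v β = ∑ j, v j * cc q β j := by
  refine linear_of_sq (fun v => QQ q v β) (hd β) ?_ v
  intro s v
  simp only [QQ]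
  rw [hsq _ (bord_skew _ (mk_skew β)), hsq _ (bord_skew _ (mk_skew β)), bord_det_smul]

include hd hsq in
lemma QQ_lin (a b : ℝ) (v w : Fin m → ℂ) (β : Prs m → ℂ) :
    QQ q (a • v + b • w) β = a * QQ q v β + b * QQ q w β := by
  simp only [QQ_eq q hd hsq, Finset.mul_sum, ← Finset.sum_add_distrib]
  refine Finset.sum_congr rfl fun j _ => ?_
  simp; ring

include hd hsq in
lemma QQ_smul (a : ℂ) (v : Fin m → ℂ) (β : Prs m → ℂ) :
    QQ q (a • v) β = a * QQ q v β := by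
  simp only [QQ_eq q hd hsq, Finset.mul_sum]
  refine Finset.sum_congr rfl fun j _ => ?_
  simp; ring

include hd hsq in
lemma QQ_star (β : Prs m → ℂ) (h : cc q β ≠ 0) : 0 < (QQ q (star (cc q β)) β).re := by
  rw [QQ_eq q hd hsq, Complex.re_sum]
  obtain ⟨j, hj⟩ := Function.ne_iff.1 h
  have e : ∀ j, (star (cc q β) j * cc q β j).re = ‖cc q β j‖ ^ 2 := by
    intro j
    rw [Pi.star_apply, Complex.star_def, ← Complex.normSq_eq_conj_mul_self, Complex.ofReal_re,
      Complex.normSq_eq_norm_sq]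
  simp only [e]
  refine Finset.sum_pos' (fun _ _ => by positivity) ⟨j, Finset.mem_univ _, ?_⟩
  have : 0 < ‖cc q β j‖ := norm_pos_iff.2 hj
  positivity

include hd hsq in
lemma cc_ne (hm : Odd m) (β : Prs m → ℂ)
    (h : ∀ T : {T : Finset (Fin m) // T.card = 3}, β ∉ Set.range (zT T.1)) : cc q β ≠ 0 := by
  intro h0
  obtain ⟨T, hT⟩ := kernel_range hm β (fun v => by
    rw [← hsq _ (bord_skew _ (mk_skew β))]
    have := QQ_eq q hd hsq v β
    rw [h0] at this
    simp only [QQ] at this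
    rw [this]; simp)
  exact h T hT

abbrev OO : Set ((Fin m → ℂ) × (Prs m → ℂ)) := {x | 0 < (QQ q x.1 x.2).re}

include hq hd hsq in
lemma exists_retr : ∃ (R : C(OO q, FF q)) (ι : C(FF q, OO q)), ∀ A, R (ι A) = A := by
  refine ⟨⟨fun x => ⟨bord ((QQ q x.1.1 x.1.2)⁻¹ • x.1.1) (mk x.1.2),
    bord_skew _ (mk_skew _), ?_⟩, ?_⟩, ⟨fun A => ⟨(fun j => A.1 0 j.succ,
      fun p => A.1 p.1.1.succ p.1.2.succ), ?_⟩, ?_⟩, ?_⟩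
  · have h : QQ q x.1.1 x.1.2 ≠ 0 := by
      intro h
      have h' : 0 < (QQ q x.1.1 x.1.2).re := x.2
      rw [h] at h'; simp at h'
    have := QQ_smul q hd hsq (QQ q x.1.1 x.1.2)⁻¹ x.1.1 x.1.2
    rw [inv_mul_cancel₀ h] at this
    exact this
  · refine Continuous.subtype_mk ?_ _
    have c1 : Continuous (fun x : OO q => QQ q x.1.1 x.1.2) :=
      (continuous_QQ q hq).comp continuous_subtype_val
    have c2 : Continuous (fun x : OO q => (QQ q x.1.1 x.1.2)⁻¹) := c1.inv₀ (fun x h => by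
      have h' : 0 < (QQ q x.1.1 x.1.2).re := x.2
      rw [h] at h'; simp at h')
    exact continuous_bord_mk.comp (Continuous.prodMk (c2.smul (by fun_prop)) (by fun_prop))
  all_goals
    have key : ∀ A : FF q, bord (fun j => A.1 0 j.succ)
        (mk (fun p : Prs m => A.1 p.1.1.succ p.1.2.succ)) = A.1 := by
      intro A
      have hA := A.2.1
      have e : mk (fun p : Prs m => A.1 p.1.1.succ p.1.2.succ) =
          A.1.submatrix Fin.succ Fin.succ := by
        refine mk_of_skew (B := A.1.submatrix Fin.succ Fin.succ) ?_
        rw [transpose_submatrix, hA]; rfl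
      rw [e]
      ext i j
      refine Fin.cases ?_ (fun i => ?_) i <;> refine Fin.cases ?_ (fun j => ?_) j
      · have := skew_apply hA 0 0
        have : A.1 0 0 = 0 := by
          have h2 : (2:ℂ) * A.1 0 0 = 0 := by linear_combination this
          simpa using h2
        simp [bord, this]
      · simp [bord]
      · simp [bord, skew_apply hA i.succ 0]
      · simp [bord]
  · simp only [OO, QQ, Set.mem_ofPred_eq]
    rw [key A, A.2.2]; simp
  · refine Continuous.subtype_mk ?_ _
    have c : ∀ i j, Continuous fun A : FF q => A.1 i j := fun i j =>
      (continuous_apply_apply i j).comp continuous_subtype_val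
    exact (continuous_pi fun j => c _ _).prodMk (continuous_pi fun p => c _ _)
  · intro A
    apply Subtype.ext
    have h1 := key A
    have h2 : QQ q (fun j => A.1 0 j.succ) (fun p : Prs m => A.1 p.1.1.succ p.1.2.succ) = 1 := by
      simp only [QQ]; rw [h1]; exact A.2.2
    simp only [ContinuousMap.coe_mk, h2, inv_one, one_smul, h1]

lemma homotopic_mk {X Y : Type*} [TopologicalSpace X] [TopologicalSpace Y] {S : Set Y}
    (f g : C(X, S)) (H : unitInterval × X → Y) (hH : Continuous H) (hS : ∀ x, H x ∈ S)
    (h0 : ∀ x, H (0, x) = f x) (h1 : ∀ x, H (1, x) = g x) : f.Homotopic g :=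
  ⟨{ toFun := fun x => ⟨H x, hS x⟩
     continuous_toFun := hH.subtype_mk _
     map_zero_left := fun x => Subtype.ext (h0 x)
     map_one_left := fun x => Subtype.ext (h1 x) }⟩

include hq hd hsq in
lemma null_OO (hm : Odd m) {k : ℕ} (hk : k ≤ 4) (f : C(Bd k, OO q)) : f.Nullhomotopic := by
  have hQ := continuous_QQ q hq
  have hO : IsOpen (OO q) := isOpen_lt continuous_const (Complex.continuous_re.comp hQ)
  have hfc : Continuous (fun y => (f y).1) := continuous_subtype_val.comp f.continuous
  obtain ⟨ε, hε, hthick⟩ := (isCompact_range hfc).exists_thickening_subset_open hO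
    (by rintro _ ⟨y, rfl⟩; exact (f y).2)
  obtain ⟨g, hg, hgε⟩ := approx (fun y => (f y).1.2) (continuous_snd.comp hfc) ε hε
  obtain ⟨b, hb⟩ := exists_generic hk g hg
  have hgc : Continuous (fun y : Bd k => g (crd y)) := hg.continuous.comp (continuous_crd k)
  have hcc : Continuous (cc q) := by
    refine continuous_pi fun j => ?_
    exact hQ.comp (continuous_const.prodMk continuous_id)
  -- stage one stays in `OO`
  have s1 : ∀ (t : unitInterval) (y : Bd k),
      ((f y).1.1, (1 - (t:ℝ)) • (f y).1.2 + (t:ℝ) • g (crd y)) ∈ OO q := by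
    intro t y
    apply hthick
    rw [Metric.mem_thickening_iff]
    refine ⟨(f y).1, ⟨y, rfl⟩, ?_⟩
    rw [Prod.dist_eq, dist_self]
    refine max_lt hε ?_
    rw [dist_eq_norm]
    have : (1 - (t:ℝ)) • (f y).1.2 + (t:ℝ) • g (crd y) - (f y).1.2 =
        (t:ℝ) • (g (crd y) - (f y).1.2) := by module
    rw [this, norm_smul, Real.norm_eq_abs, abs_of_nonneg t.2.1]
    exact (mul_le_of_le_one_left (norm_nonneg _) t.2.2).trans_lt (hgε y)
  have s1' : ∀ y : Bd k, ((f y).1.1, g (crd y)) ∈ OO q := by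
    intro y; simpa using s1 1 y
  have ne0 : ∀ y : Bd k, cc q (g (crd y)) ≠ 0 := by
    intro y h
    have := s1' y
    simp only [OO, Set.mem_ofPred_eq] at this
    rw [QQ_eq q hd hsq, h] at this
    simp at this
  have ne1 : ∀ (t : unitInterval) (y : Bd k),
      cc q ((1 - (t:ℝ)) • g (crd y) + (t:ℝ) • b) ≠ 0 := by
    intro t y
    rcases eq_or_ne (t:ℝ) 0 with h | h
    · simpa [h] using ne0 y
    · obtain ⟨i, hi⟩ := y.2
      refine cc_ne q hd hsq hm _ fun T => hb T (crd y) i ?_ t h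
      rcases hi with hi | hi
      · left; simp [crd, hi]
      · right; simp [crd, hi]
  have neb : cc q b ≠ 0 ∨ IsEmpty (Bd k) := by
    rcases isEmpty_or_nonempty (Bd k) with h | ⟨⟨y⟩⟩
    · exact Or.inr h
    · left; simpa using ne1 1 y
  have s2 : ∀ (t : unitInterval) (y : Bd k),
      ((1 - (t:ℝ)) • (f y).1.1 + (t:ℝ) • star (cc q (g (crd y))), g (crd y)) ∈ OO q := by
    intro t y
    simp only [OO, Set.mem_ofPred_eq]
    rw [QQ_lin q hd hsq]
    have h1 : 0 < (QQ q (f y).1.1 (g (crd y))).re := s1' y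
    have h2 := QQ_star q hd hsq _ (ne0 y)
    have t0 := t.2.1
    have t1 := t.2.2
    simp only [Complex.add_re, Complex.re_ofReal_mul]
    rcases eq_or_lt_of_le t0 with h | h
    · rw [← h]; simpa using h1
    · have : 0 ≤ (1 - (t:ℝ)) := by linarith
      positivity
  have s3 : ∀ (t : unitInterval) (y : Bd k),
      (star (cc q ((1 - (t:ℝ)) • g (crd y) + (t:ℝ) • b)),
        (1 - (t:ℝ)) • g (crd y) + (t:ℝ) • b) ∈ OO q := fun t y =>
    QQ_star q hd hsq _ (ne1 t y)
  have y0 : Bd k := ⟨fun _ => 0, ⟨0, Or.inl rfl⟩⟩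
  have sb : (star (cc q b), b) ∈ OO q := by simpa using s3 1 y0
  have c2 : Continuous fun y : Bd k => (f y).1.2 := continuous_snd.comp hfc
  have c1 : Continuous fun y : Bd k => (f y).1.1 := continuous_fst.comp hfc
  have c2' : Continuous fun x : unitInterval × Bd k => (f x.2).1.2 := c2.comp continuous_snd
  have c1' : Continuous fun x : unitInterval × Bd k => (f x.2).1.1 := c1.comp continuous_snd
  have hgc' : Continuous fun x : unitInterval × Bd k => g (crd x.2) := hgc.comp continuous_snd
  have ct : Continuous fun x : unitInterval × Bd k => (x.1 : ℝ) := by fun_prop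
  let f1 : C(Bd k, OO q) := ⟨fun y => ⟨_, s1' y⟩, (c1.prodMk hgc).subtype_mk _⟩
  let f2 : C(Bd k, OO q) := ⟨fun y => ⟨(star (cc q (g (crd y))), g (crd y)),
    QQ_star q hd hsq _ (ne0 y)⟩, ((hcc.comp hgc).star.prodMk hgc).subtype_mk _⟩
  have g1 : f.Homotopic f1 := by
    refine homotopic_mk f f1 (fun x => ((f x.2).1.1, (1 - (x.1:ℝ)) • (f x.2).1.2 + (x.1:ℝ) • g (crd x.2)))
      (c1'.prodMk (((continuous_const.sub ct).smul c2').add (ct.smul hgc')))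
      (fun x => s1 x.1 x.2) ?_ ?_
    · intro y; simp
    · intro y; simp [f1]
  have g2 : f1.Homotopic f2 := by
    refine homotopic_mk f1 f2 (fun x => ((1 - (x.1:ℝ)) • (f x.2).1.1 +
      (x.1:ℝ) • star (cc q (g (crd x.2))), g (crd x.2)))
      ((((continuous_const.sub ct).smul c1').add (ct.smul (hcc.comp hgc').star)).prodMk hgc')
      (fun x => s2 x.1 x.2) ?_ ?_
    · intro y; simp [f1]
    · intro y; simp [f2]
  have cg : Continuous fun x : unitInterval × Bd k =>
      (1 - (x.1:ℝ)) • g (crd x.2) + (x.1:ℝ) • b :=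
    ((continuous_const.sub ct).smul hgc').add (ct.smul continuous_const)
  have g3 : f2.Homotopic (ContinuousMap.const _ ⟨_, sb⟩) := by
    refine homotopic_mk f2 _ (fun x => (star (cc q ((1 - (x.1:ℝ)) • g (crd x.2) + (x.1:ℝ) • b)),
        (1 - (x.1:ℝ)) • g (crd x.2) + (x.1:ℝ) • b))
      ((hcc.comp cg).star.prodMk cg)
      (fun x => s3 x.1 x.2) ?_ ?_
    · intro y; simp [f2]
    · intro y; simp
  exact ⟨_, g1.trans (g2.trans g3)⟩

include hq hd hsq in
lemma null_FF (hm : Odd m) {k : ℕ} (hk : k ≤ 4) (f : C(Bd k, FF q)) : f.Nullhomotopic := by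
  obtain ⟨R, ι, h⟩ := exists_retr q hq hd hsq
  have := (null_OO q hq hd hsq hm hk (ι.comp f)).comp_right R
  have e : R.comp (ι.comp f) = f := by ext1 y; simp [h]
  rwa [e] at this

include hq hd hsq in
lemma nonempty_FF (hm : Odd m) : (FF q).Nonempty := by
  obtain ⟨R, ι, h⟩ := exists_retr q hq hd hsq
  obtain ⟨b, hb⟩ := exists_generic (m := m) (k := 0) (by norm_num) (fun _ => 0) contDiff_const
  have := cc_ne q hd hsq hm b fun T => by
    simpa using hb T (fun _ => 0) 0 (Or.inl rfl) 1 one_ne_zero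
  exact ⟨_, (R ⟨(star (cc q b), b), QQ_star q hd hsq b this⟩).2⟩

end main

open scoped unitInterval

noncomputable def conePt {k : ℕ} (x : I × Bd k) : Fin (k+1) → I := fun i =>
  ⟨(1 - (x.1:ℝ)) * (x.2.1 i : ℝ) + (x.1:ℝ) * (1/2), by
    have h0 := x.1.2.1
    have h1 := x.1.2.2
    have g0 := (x.2.1 i).2.1
    have g1 := (x.2.1 i).2.2
    constructor
    · have : 0 ≤ 1 - (x.1:ℝ) := by linarith
      positivity
    · nlinarith⟩

lemma continuous_conePt (k : ℕ) : Continuous (conePt : I × Bd k → _) := by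
  refine continuous_pi fun i => Continuous.subtype_mk ?_ _
  have c1 : Continuous fun x : I × Bd k => (x.1:ℝ) := by fun_prop
  have c2 : Continuous fun x : I × Bd k => (x.2.1 i:ℝ) :=
    continuous_subtype_val.comp ((continuous_apply i).comp
      (continuous_subtype_val.comp continuous_snd))
  exact ((continuous_const.sub c1).mul c2).add (c1.mul continuous_const)

lemma conePt_le {k : ℕ} {x x' : I × Bd k} (h : conePt x = conePt x') : (x.1:ℝ) ≤ x'.1 := by
  obtain ⟨i, hi⟩ := x'.2.2
  have e : (1 - (x.1:ℝ)) * (x.2.1 i : ℝ) + (x.1:ℝ) * (1/2) =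
      (1 - (x'.1:ℝ)) * (x'.2.1 i : ℝ) + (x'.1:ℝ) * (1/2) := congrArg Subtype.val (congrFun h i)
  have h1 : 0 ≤ 1 - (x.1:ℝ) := by linarith [x.1.2.2]
  have g0 := mul_nonneg h1 (x.2.1 i).2.1
  have g1 := mul_nonneg h1 (sub_nonneg.2 (x.2.1 i).2.2)
  rcases hi with hi | hi
  · rw [hi] at e; simp only [Set.Icc.coe_zero] at e; linarith
  · rw [hi] at e; simp only [Set.Icc.coe_one] at e; linarith

lemma conePt_eq {k : ℕ} {x x' : I × Bd k} (h : conePt x = conePt x') :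
    x.1 = x'.1 ∧ (x.1 = 1 ∨ x.2 = x'.2) := by
  have e1 : x.1 = x'.1 := Subtype.ext (le_antisymm (conePt_le h) (conePt_le h.symm))
  refine ⟨e1, ?_⟩
  by_cases h1 : x.1 = 1
  · exact Or.inl h1
  right
  refine Subtype.ext (funext fun i => Subtype.ext ?_)
  have e : (1 - (x.1:ℝ)) * (x.2.1 i : ℝ) + (x.1:ℝ) * (1/2) =
      (1 - (x'.1:ℝ)) * (x'.2.1 i : ℝ) + (x'.1:ℝ) * (1/2) := congrArg Subtype.val (congrFun h i)
  rw [← e1] at e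
  have : (1 - (x.1:ℝ)) ≠ 0 := fun h => h1 (Subtype.ext (by rw [Set.Icc.coe_one]; linarith))
  exact mul_left_cancel₀ this (by linarith)

lemma conePt_surj (k : ℕ) : Function.Surjective (conePt : I × Bd k → _) := by
  intro z
  obtain ⟨i, -, hi⟩ := Finset.exists_max_image Finset.univ (fun i => |(z i : ℝ) - 1/2|)
    ⟨0, Finset.mem_univ _⟩
  set r := |(z i : ℝ) - 1/2| with hr
  have hr2 : r ≤ 1/2 := by
    rw [hr, abs_le]; constructor <;> linarith [(z i).2.1, (z i).2.2]
  rcases eq_or_lt_of_le (abs_nonneg ((z i : ℝ) - 1/2)) with h0 | h0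
  · refine ⟨(1, ⟨fun _ => 0, ⟨0, Or.inl rfl⟩⟩), funext fun j => Subtype.ext ?_⟩
    have := hi j (Finset.mem_univ _)
    rw [hr, ← h0] at this
    have := abs_eq_zero.1 (le_antisymm this (abs_nonneg _))
    simp [conePt]; linarith
  · rw [← hr] at h0
    have hb : ∀ j, |((z j:ℝ) - 1/2) / (2 * r)| ≤ 1/2 := fun j => by
      rw [abs_div, abs_of_pos (by positivity : 0 < 2 * r), div_le_iff₀ (by positivity)]
      linarith [hi j (Finset.mem_univ _)]
    refine ⟨(⟨1 - 2 * r, by constructor <;> linarith⟩,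
      ⟨fun j => ⟨((z j:ℝ) - 1/2) / (2 * r) + 1/2, ?_⟩, ⟨i, ?_⟩⟩), funext fun j => Subtype.ext ?_⟩
    · have := abs_le.1 (hb j)
      constructor <;> linarith
    · rcases abs_choice ((z i:ℝ) - 1/2) with h | h
      · right; apply Subtype.ext
        rw [← hr] at h
        simp only [← h, Set.Icc.coe_one]; field_simp; norm_num
      · left; apply Subtype.ext
        rw [← hr] at h
        have : (z i:ℝ) - 1/2 = - r := by linarith
        simp only [this, Set.Icc.coe_zero]; field_simp; norm_num
    · simp only [conePt]; field_simp; ring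

lemma extend_null {k : ℕ} {X : Type*} [TopologicalSpace X] (φ : C(Bd k, X))
    (h : φ.Nullhomotopic) : ∃ Φ : C(Fin (k+1) → I, X), ∀ y : Bd k, Φ y.1 = φ y := by
  obtain ⟨c, ⟨H⟩⟩ := h
  have hq : Topology.IsQuotientMap (conePt : I × Bd k → _) :=
    (continuous_conePt k).isClosedMap.isQuotientMap (continuous_conePt k) (conePt_surj k)
  have hf : Function.FactorsThrough (fun x : I × Bd k => H x) conePt := by
    intro x x' e
    obtain ⟨h1, h2⟩ := conePt_eq e
    rcases h2 with h2 | h2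
    · have e1 : x = (1, x.2) := Prod.ext h2 rfl
      have e2 : x' = (1, x'.2) := Prod.ext (h1 ▸ h2) rfl
      rw [e1, e2]; simp
    · rw [Prod.ext h1 h2]
  let q' : C(I × Bd k, Fin (k+1) → I) := ⟨conePt, continuous_conePt k⟩
  refine ⟨Topology.IsQuotientMap.lift (f := q') hq H.toContinuousMap hf, fun y => ?_⟩
  have e : y.1 = q' (0, y) := by
    funext i; apply Subtype.ext; simp [q', conePt]
  rw [e]
  have := DFunLike.congr_fun (Topology.IsQuotientMap.lift_comp (f := q') hq H.toContinuousMap hf) (0, y)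
  refine Eq.trans this ?_
  simp

lemma pathConn {X : Type*} [TopologicalSpace X] [Nonempty X]
    (h : ∀ φ : C(Bd 0, X), φ.Nullhomotopic) : PathConnectedSpace X := by
  refine ⟨inferInstance, fun a b => ?_⟩
  have hcont : Continuous (fun y : Bd 0 => if y.1 0 = 0 then a else b) := by
    have hc : Continuous (fun y : Bd 0 => y.1 0) := (continuous_apply 0).comp continuous_subtype_val
    rw [← continuousOn_univ]
    have : (Set.univ : Set (Bd 0)) = {y | y.1 0 = 0} ∪ {y | y.1 0 = 1} := by
      ext y
      obtain ⟨i, hi⟩ := y.2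
      rw [show i = 0 from Subsingleton.elim (α := Fin 1) i 0] at hi
      simpa using hi
    rw [this]
    refine ContinuousOn.union_of_isClosed ?_ ?_ (isClosed_eq hc continuous_const)
      (isClosed_eq hc continuous_const)
    · refine (continuousOn_const (c := a)).congr ?_
      intro y hy
      exact if_pos hy
    · refine (continuousOn_const (c := b)).congr ?_
      intro y hy
      refine if_neg fun h => ?_
      have hy' : y.1 0 = 1 := hy
      rw [h] at hy'
      exact zero_ne_one hy'
  obtain ⟨Φ, hΦ⟩ := extend_null ⟨_, hcont⟩ (h _)
  refine ⟨⟨⟨fun t => Φ fun _ => t, by fun_prop⟩, ?_, ?_⟩⟩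
  · have := hΦ ⟨fun _ => 0, ⟨0, Or.inl rfl⟩⟩
    simpa using this
  · have := hΦ ⟨fun _ => 1, ⟨0, Or.inr rfl⟩⟩
    simpa using this

lemma subsing_pi {X : Type*} [TopologicalSpace X] (x : X) {k : ℕ}
    (h : ∀ φ : C(Bd k, X), φ.Nullhomotopic) : Subsingleton (HomotopyGroup (Fin k) X x) := by
  have key : ∀ f : GenLoop (Fin k) X x, GenLoop.Homotopic f GenLoop.const := by
    intro f
    have hfb : ∀ y ∈ Cube.boundary (Fin k), f y = x := f.2
    have hcont : Continuous (fun y : Bd k => if y.1 0 = 0 then f (Fin.tail y.1) else x) := by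
      have hc : Continuous (fun y : Bd k => y.1 0) :=
        (continuous_apply 0).comp continuous_subtype_val
      have hc' : Continuous (fun y : Bd k => Fin.tail y.1) :=
        continuous_pi fun i => (continuous_apply i.succ).comp continuous_subtype_val
      rw [← continuousOn_univ]
      have : (Set.univ : Set (Bd k)) = {y | y.1 0 = 0} ∪
          ({y | y.1 0 = 1} ∪ {y | (Fin.tail y.1 : Fin k → I) ∈ Cube.boundary (Fin k)}) := by
        symm
        rw [Set.eq_univ_iff_forall]
        intro y
        obtain ⟨i, hi⟩ := y.2
        revert hi
        refine Fin.cases ?_ (fun i => ?_) i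
        · rintro (hi | hi)
          · exact Or.inl hi
          · exact Or.inr (Or.inl hi)
        · intro hi
          exact Or.inr (Or.inr ⟨i, hi⟩)
      rw [this]
      refine ContinuousOn.union_of_isClosed ?_ ?_ (isClosed_eq hc continuous_const)
        ((isClosed_eq hc continuous_const).union ((isClosed_cube_boundary k).preimage hc'))
      · refine (f.1.continuous.comp hc').continuousOn.congr ?_
        intro y hy
        exact if_pos hy
      · refine (continuousOn_const (c := x)).congr ?_
        rintro y (hy | hy)
        · refine if_neg fun h => ?_
          have hy' : y.1 0 = 1 := hy
          rw [h] at hy'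
          exact zero_ne_one hy'
        · have := hfb _ hy
          simp only [this, ite_self]
    obtain ⟨Φ, hΦ⟩ := extend_null ⟨_, hcont⟩ (h _)
    have hΦ' : ∀ (t : I) (y : Fin k → I) (hb : (Fin.cons t y : Fin (k+1) → I) ∈ Cube.boundary _),
        Φ (Fin.cons t y) = if t = 0 then f y else x := by
      intro t y hb
      have := hΦ ⟨_, hb⟩
      simpa using this
    have c : Continuous fun p : I × (Fin k → I) => (Fin.cons p.1 p.2 : Fin (k+1) → I) := by
      refine continuous_pi fun i => ?_
      refine Fin.cases ?_ (fun i => ?_) i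
      · simpa using continuous_fst
      · simp only [Fin.cons_succ]; fun_prop
    refine ⟨{ toFun := fun p => Φ (Fin.cons p.1 p.2)
              continuous_toFun := Φ.continuous.comp c
              map_zero_left := fun y => ?_
              map_one_left := fun y => ?_
              prop' := fun t y hy => ?_ }⟩
    · rw [hΦ' _ _ ⟨0, by simp⟩]; simp
    · rw [hΦ' _ _ ⟨0, by simp⟩]; simp
    · obtain ⟨i, hi⟩ := hy
      have e := hfb y ⟨i, hi⟩
      have : Φ (Fin.cons t y) = x := by
        rw [hΦ' _ _ ⟨i.succ, by simpa using hi⟩, e, ite_self]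
      exact this.trans e.symm
  refine ⟨fun a b => ?_⟩
  induction a using Quotient.inductionOn with | _ a
  induction b using Quotient.inductionOn with | _ b
  exact Quotient.sound ((key a).trans (key b).symm)

lemma main_N {N : ℕ} (n : ℕ) (hn : 1 ≤ n) (hN : N = 2 * n)
    (P : MvPolynomial {p : Fin N × Fin N // p.1 < p.2} ℂ)
    (q : Matrix (Fin N) (Fin N) ℂ → ℂ)
    (hqP : ∀ A, q A = MvPolynomial.eval (fun v => A v.1.1 v.1.2) P)
    (hsq : ∀ A, Aᵀ = -A → q A ^ 2 = A.det) :
    ({A : Matrix (Fin N) (Fin N) ℂ | Aᵀ = -A ∧ q A = 1}).Nonempty ∧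
    PathConnectedSpace {A : Matrix (Fin N) (Fin N) ℂ | Aᵀ = -A ∧ q A = 1} ∧
    ∀ x : {A : Matrix (Fin N) (Fin N) ℂ | Aᵀ = -A ∧ q A = 1},
      ∀ k : ℕ, 1 ≤ k → k ≤ 4 →
        Subsingleton (HomotopyGroup (Fin k)
          {A : Matrix (Fin N) (Fin N) ℂ | Aᵀ = -A ∧ q A = 1} x) := by
  obtain ⟨l, rfl⟩ : ∃ l, n = l + 1 := ⟨n - 1, by omega⟩
  obtain ⟨m, rfl⟩ : ∃ m, N = m + 1 := ⟨N - 1, by omega⟩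
  have hm : Odd m := ⟨l, by omega⟩
  have hq : Continuous q := by
    have : q = fun A => MvPolynomial.eval (fun v => A v.1.1 v.1.2) P := funext hqP
    rw [this]
    refine (MvPolynomial.continuous_eval P).comp (continuous_pi fun v => ?_)
    exact continuous_apply_apply v.1.1 v.1.2
  have hd : ∀ β : Prs m → ℂ, Differentiable ℂ (fun v : Fin m → ℂ => q (bord v (mk β))) := by
    intro β
    have h1 : ∀ i j, Differentiable ℂ fun v : Fin m → ℂ => bord v (mk β) i j := by
      intro i j
      refine Fin.cases ?_ (fun i => ?_) i <;> refine Fin.cases ?_ (fun j => ?_) j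
      · simp only [bord, Matrix.of_apply, Fin.cons_zero]; fun_prop
      · simp only [bord, Matrix.of_apply, Fin.cons_zero, Fin.cons_succ]; fun_prop
      · simp only [bord, Matrix.of_apply, Fin.cons_zero, Fin.cons_succ]; fun_prop
      · simp only [bord, Matrix.of_apply, Fin.cons_succ]; fun_prop
    have h2 : ∀ p : MvPolynomial {p : Fin (m+1) × Fin (m+1) // p.1 < p.2} ℂ,
        Differentiable ℂ fun v : Fin m → ℂ =>
          MvPolynomial.eval (fun w => bord v (mk β) w.1.1 w.1.2) p := by
      intro p
      induction p using MvPolynomial.induction_on with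
      | C a => simp
      | add p p' h h' => simp only [map_add]; exact h.add h'
      | mul_X p i h => simp only [map_mul, eval_X]; exact h.mul (h1 _ _)
    simpa only [hqP] using h2 P
  have hne : (FF q).Nonempty := nonempty_FF q hq hd hsq hm
  have hnull : ∀ {k : ℕ}, k ≤ 4 → ∀ φ : C(Bd k, FF q), φ.Nullhomotopic :=
    fun hk φ => null_FF q hq hd hsq hm hk φ
  have : Nonempty (FF q) := hne.to_subtype
  exact ⟨hne, pathConn (hnull (by norm_num)), fun x k _ hk => subsing_pi x (hnull hk)⟩

/-- The global Milnor fibre `F = {A skew-symmetric | Pf(A) = 1}` of the Pfaffian is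
4-connected: it is nonempty, path-connected, and its homotopy groups `π_k` vanish for
`1 ≤ k ≤ 4`. -/
theorem pfaffian_milnor_fibre_four_connected (n : ℕ) (hn : 1 ≤ n)
    (Pf : MvPolynomial (SkewIdx n) ℂ) (hPf : Pf * Pf = (genSkew n).det) :
    ({A : Matrix (Fin (2 * n)) (Fin (2 * n)) ℂ | Aᵀ = -A ∧ pfEval n Pf A = 1}).Nonempty ∧
    PathConnectedSpace
      {A : Matrix (Fin (2 * n)) (Fin (2 * n)) ℂ | Aᵀ = -A ∧ pfEval n Pf A = 1} ∧
    ∀ x : {A : Matrix (Fin (2 * n)) (Fin (2 * n)) ℂ | Aᵀ = -A ∧ pfEval n Pf A = 1},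
      ∀ k : ℕ, 1 ≤ k → k ≤ 4 →
        Subsingleton (HomotopyGroup (Fin k)
          {A : Matrix (Fin (2 * n)) (Fin (2 * n)) ℂ | Aᵀ = -A ∧ pfEval n Pf A = 1} x) := by
  refine main_N n hn rfl Pf (pfEval n Pf) (fun A => rfl) ?_
  intro A hA
  have h := congrArg (MvPolynomial.eval (fun v : SkewIdx n => A v.1.1 v.1.2)) hPf
  rw [map_mul, RingHom.map_det] at h
  have e : (MvPolynomial.eval (fun v : SkewIdx n => A v.1.1 v.1.2)).mapMatrix (genSkew n) = A := by
    ext i j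
    rw [RingHom.mapMatrix_apply, Matrix.map_apply]
    unfold genSkew
    split_ifs with h1 h2
    · exact eval_X _
    · rw [map_neg]
      exact (congrArg Neg.neg (eval_X _)).trans (skew_apply hA i j).symm
    · obtain rfl : i = j := le_antisymm (not_lt.1 h2) (not_lt.1 h1)
      have h3 := skew_apply hA i i
      have h4 : (2:ℂ) * A i i = 0 := by linear_combination h3
      rw [map_zero]
      symm
      simpa using h4
  rw [e] at h
  rw [sq]
  exact h
end

section
/- The space U = {A : Matrix (Fin 6) (Fin 6) ℂ | Aᵀ = −A ∧ A.rank = 2}, with its subspace topology, is simply connected (path-connected with trivial fundamental group). (U is the punctured affine cone over the Grassmannian Gr(2,6) in its Plücker embedding, i.e. the set of nonzero skew-symmetric 6×6 matrices of rank at most 2.) -/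
open Matrix

theorem vk_homotopic {X : Type*} [TopologicalSpace X] {V : Set X} (hV : IsSimplyConnected V)
    {x y : X} (p q : Path x y) (hp : ∀ t, p t ∈ V) (hq : ∀ t, q t ∈ V) : p.Homotopic q := by
  have : SimplyConnectedSpace V := hV
  have hx : x ∈ V := by simpa using hp 0
  have hy : y ∈ V := by simpa using hp 1
  let p' : Path (⟨x, hx⟩ : V) ⟨y, hy⟩ :=
    { toFun := fun t ↦ ⟨p t, hp t⟩, source' := by simp, target' := by simp }
  let q' : Path (⟨x, hx⟩ : V) ⟨y, hy⟩ :=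
    { toFun := fun t ↦ ⟨q t, hq t⟩, source' := by simp, target' := by simp }
  have h := (SimplyConnectedSpace.paths_homotopic p' q').map ⟨Subtype.val, continuous_subtype_val⟩
  exact h

theorem vk_trans_mem {X : Type*} [TopologicalSpace X] {V : Set X} {x y z : X}
    (p : Path x y) (q : Path y z) (hp : ∀ t, p t ∈ V) (hq : ∀ t, q t ∈ V) (t) :
    p.trans q t ∈ V := by
  have : p.trans q t ∈ Set.range (p.trans q) := ⟨t, rfl⟩
  rw [Path.trans_range] at this
  rcases this with ⟨s, hs⟩ | ⟨s, hs⟩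
  · rw [← hs]; exact hp s
  · rw [← hs]; exact hq s

theorem vk_simply {X : Type*} [TopologicalSpace X] {ι : Type*} (V : ι → Set X)
    (hVo : ∀ i, IsOpen (V i)) (hVs : ∀ i, IsSimplyConnected (V i))
    (x0 : X) (hx0 : ∀ i, x0 ∈ V i) (hV2 : ∀ i j, IsPathConnected (V i ∩ V j))
    (hcov : ∀ x, ∃ i, x ∈ V i) : SimplyConnectedSpace X := by
  have join : ∀ i j y, y ∈ V i → y ∈ V j →
      ∃ p : Path x0 y, (∀ t, p t ∈ V i) ∧ (∀ t, p t ∈ V j) := by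
    intro i j y hi hj
    obtain ⟨p, hp⟩ := (hV2 i j).joinedIn x0 ⟨hx0 i, hx0 j⟩ y ⟨hi, hj⟩
    exact ⟨p, fun t ↦ (hp t).1, fun t ↦ (hp t).2⟩
  have key : ∀ (x y : X) (γ : Path x y), x = x0 → ∀ i (δ : Path x y), (∀ t, δ t ∈ V i) →
      γ.Homotopic δ := by
    intro x y γ hx i δ hδ
    subst hx
    obtain ⟨t, ht0, htm, ⟨n, hn⟩, htc⟩ := exists_monotone_Icc_subset_open_cover_unitInterval
      (c := fun i ↦ γ ⁻¹' V i) (fun i ↦ (hVo i).preimage γ.continuous)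
      (fun s _ ↦ by simpa using hcov (γ s))
    have claim : ∀ k, ∀ s, t k = s → ∀ j (ε : Path (γ 0) (γ s)), (∀ r, ε r ∈ V j) →
        (γ.subpath 0 s).Homotopic ε := by
      intro k
      induction k with
      | zero =>
        intro s hs j ε hε
        rw [ht0] at hs
        subst hs
        rw [Path.subpath_self]
        refine vk_homotopic (hVs j) _ _ (fun r ↦ ?_) hε
        simpa using hx0 j
      | succ k ih =>
        intro s hs j ε hε
        subst hs
        obtain ⟨l, hl⟩ := htc k
        have hle : t k ≤ t (k+1) := htm (Nat.le_succ k)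
        have hk1 : γ (t k) ∈ V l := hl ⟨le_rfl, hle⟩
        have hk2 : γ (t (k+1)) ∈ V l := hl ⟨hle, le_rfl⟩
        have hk3 : γ (t (k+1)) ∈ V j := by simpa using hε 1
        obtain ⟨δ1, hδ1, -⟩ := join l l _ hk1 hk1
        obtain ⟨δ2, hδ2, hδ2'⟩ := join l j _ hk2 hk3
        have hseg : ∀ r, γ.subpath (t k) (t (k+1)) r ∈ V l := by
          intro r
          have : γ.subpath (t k) (t (k+1)) r ∈ Set.range (γ.subpath (t k) (t (k+1))) := ⟨r, rfl⟩
          rw [Path.range_subpath_of_le _ _ _ hle] at this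
          obtain ⟨w, hw, hw'⟩ := this
          rw [← hw']
          exact hl hw
        have e1 := ih (t k) rfl l (δ1.cast (by simp) rfl) hδ1
        have e2 : ((γ.subpath 0 (t k)).trans (γ.subpath (t k) (t (k+1)))).Homotopic
            (γ.subpath 0 (t (k+1))) := ⟨Path.Homotopy.subpathTransSubpath γ _ _ _⟩
        have e3 := Path.Homotopic.hcomp e1 (Path.Homotopic.refl (γ.subpath (t k) (t (k+1))))
        have e4 := vk_homotopic (hVs l) ((δ1.cast (γ.source) rfl).trans
          (γ.subpath (t k) (t (k+1)))) (δ2.cast (γ.source) rfl)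
          (vk_trans_mem _ _ hδ1 hseg) hδ2
        have e5 := vk_homotopic (hVs j) (δ2.cast (γ.source) rfl) ε hδ2' hε
        exact e2.symm.trans (e3.trans (e4.trans e5))
    have h := claim n 1 (hn n le_rfl) i (δ.cast γ.source γ.target) hδ
    rw [Path.subpath_zero_one] at h
    exact h.pathCast γ.source.symm γ.target.symm
  have hpc : PathConnectedSpace X := by
    have hj : ∀ y, Joined x0 y := by
      intro y
      obtain ⟨i, hi⟩ := hcov y
      obtain ⟨p, -⟩ := join i i y hi hi
      exact ⟨p⟩
    exact ⟨⟨x0⟩, fun x y ↦ (hj x).symm.trans (hj y)⟩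
  refine simply_connected_iff_paths_homotopic'.2 ⟨hpc, ?_⟩
  intro x y p q
  obtain ⟨i, hi⟩ := hcov y
  obtain ⟨δ, hδ, -⟩ := join i i y hi hi
  obtain ⟨α⟩ := PathConnectedSpace.joined x0 x
  have h1 := key _ _ (α.trans p) rfl i δ hδ
  have h2 := key _ _ (α.trans q) rfl i δ hδ
  have h3 := h1.trans h2.symm
  rw [← Path.Homotopic.Quotient.eq] at h3 ⊢
  rw [Path.Homotopic.Quotient.mk_trans, Path.Homotopic.Quotient.mk_trans] at h3
  have h4 := congrArg (Path.Homotopic.Quotient.trans (Path.Homotopic.Quotient.symm (.mk α))) h3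
  simpa [← Path.Homotopic.Quotient.trans_assoc] using h4

theorem vk_set {E : Type*} [TopologicalSpace E] {ι : Type*} (S : Set E) (V : ι → Set E)
    (hVo : ∀ i, IsOpen (V i)) (hVs : ∀ i, IsSimplyConnected (S ∩ V i))
    (x0 : E) (hx : x0 ∈ S) (hx0 : ∀ i, x0 ∈ V i)
    (hV2 : ∀ i j, IsPathConnected (S ∩ (V i ∩ V j)))
    (hcov : ∀ x ∈ S, ∃ i, x ∈ V i) : SimplyConnectedSpace S := by
  refine vk_simply (fun i ↦ ((↑) : S → E) ⁻¹' V i)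
    (fun i ↦ (hVo i).preimage continuous_subtype_val) ?_ ⟨x0, hx⟩ hx0 ?_ (fun x ↦ hcov x x.2)
  · intro i
    rw [← Topology.IsEmbedding.subtypeVal.isSimplyConnected_image, Subtype.image_preimage_coe]
    exact hVs i
  · intro i j
    rw [Topology.IsInducing.subtypeVal.isPathConnected_iff, ← Set.preimage_inter,
      Subtype.image_preimage_coe]
    exact hV2 i j

theorem punct_simply {E : Type*} [NormedAddCommGroup E] [NormedSpace ℝ E] [FiniteDimensional ℝ E]
    (hE : 2 < Module.finrank ℝ E) : IsSimplyConnected ({0}ᶜ : Set E) := by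
  have : Nontrivial E := Module.nontrivial_of_finrank_pos (R := ℝ) (by omega)
  obtain ⟨v, hv⟩ := exists_ne (0 : E)
  let V : Bool → Set E := fun b ↦ ((fun t : ℝ ↦ t • (if b then v else -v)) '' Set.Ici 0)ᶜ
  have hwne : ∀ b : Bool, (if b then v else -v) ≠ 0 := by intro b; cases b <;> simpa
  have hVo : ∀ b, IsOpen (V b) := fun b ↦
    (isClosedMap_smul_left _ _ isClosed_Ici).isOpen_compl
  have hV0 : ∀ b, V b ⊆ {0}ᶜ := by
    intro b x hx h0
    apply hx
    exact ⟨0, by simp, by simpa using h0.symm⟩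
  have hpc : IsPathConnected (((Submodule.span ℝ {v} : Submodule ℝ E) : Set E)ᶜ) := by
    apply isPathConnected_compl_of_one_lt_codim
    rw [← Module.finrank_eq_rank]
    have h1 := Submodule.finrank_quotient_add_finrank (Submodule.span ℝ {v})
    have h2 := finrank_span_singleton (K := ℝ) hv
    have : 1 < Module.finrank ℝ (E ⧸ Submodule.span ℝ {v}) := by omega
    exact_mod_cast this
  have hstar : ∀ b, IsSimplyConnected (V b) := by
    intro b
    set w := (if b then v else -v) with hw
    have hw0 : w ≠ 0 := hwne b
    have hmem : -w ∈ V b := by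
      rintro ⟨t, ht, h⟩
      have : (t + 1) • w = 0 := by rw [add_smul, one_smul]; simp only [← hw] at h; rw [h]; simp
      rcases smul_eq_zero.1 this with h | h
      · have := Set.mem_Ici.1 ht; linarith
      · exact hw0 h
    have : StarConvex ℝ (-w) (V b) := by
      intro x hx a c ha hc hac
      rintro ⟨t, ht, h⟩
      simp only [← hw] at h
      have ht' : 0 ≤ t := ht
      rcases hc.eq_or_lt with h0 | h0
      · subst h0
        have : a = 1 := by linarith
        subst this
        apply hmem
        exact ⟨t, ht, by simp only [← hw]; rw [h]; simp⟩
      · apply hx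
        refine ⟨(t + a) / c, by simp only [Set.mem_Ici]; positivity, ?_⟩
        simp only [← hw]
        have : c • x = (t + a) • w := by rw [add_smul, h]; simp
        rw [div_eq_inv_mul, mul_smul, ← this, smul_smul, inv_mul_cancel₀ h0.ne', one_smul]
    have := this.contractibleSpace ⟨_, hmem⟩
    exact SimplyConnectedSpace.ofContractible (V b)
  have hspan : ((Submodule.span ℝ {v} : Submodule ℝ E) : Set E)ᶜ = V true ∩ V false := by
    ext x
    simp only [V, Set.mem_compl_iff, SetLike.mem_coe, Submodule.mem_span_singleton, Set.mem_inter_iff,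
      Set.mem_image, Set.mem_Ici]
    constructor
    · intro h
      refine ⟨fun ⟨t, _, h'⟩ ↦ h ⟨t, by simpa using h'⟩, fun ⟨t, _, h'⟩ ↦ h ⟨-t, by simpa using h'⟩⟩
    · rintro ⟨h1, h2⟩ ⟨t, h⟩
      rcases le_total 0 t with h0 | h0
      · exact h1 ⟨t, h0, by simpa using h⟩
      · exact h2 ⟨-t, by linarith, by simpa using h⟩
  obtain ⟨x0, hx0⟩ := hpc.nonempty
  have hx0' := hx0
  rw [hspan] at hx0'
  have hint : ∀ b, ({0}ᶜ : Set E) ∩ V b = V b := fun b ↦ Set.inter_eq_right.2 (hV0 b)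
  refine vk_set _ V hVo ?_ x0 (hV0 _ hx0'.1) ?_ ?_ ?_
  · intro b; rw [hint]; exact hstar b
  · intro b; cases b
    exacts [hx0'.2, hx0'.1]
  · intro a b
    rw [← Set.inter_assoc, hint]
    cases a <;> cases b
    · rw [Set.inter_self]; exact (hstar _).isPathConnected
    · rw [Set.inter_comm, ← hspan]; exact hpc
    · rw [← hspan]; exact hpc
    · rw [Set.inter_self]; exact (hstar _).isPathConnected
  · intro x hx
    by_contra! h
    have h1 := h true
    have h2 := h false
    simp only [V, Set.mem_compl_iff, not_not] at h1 h2
    obtain ⟨t, ht, h1⟩ := h1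
    obtain ⟨s, hs, h2⟩ := h2
    simp only [if_true] at h1
    simp at h2
    have : (t + s) • v = 0 := by rw [add_smul, h1, ← h2]; simp
    rcases smul_eq_zero.1 this with h | h
    · have h3 : 0 ≤ t := ht
      have h4 : 0 ≤ s := hs
      have : t = 0 := by linarith
      subst this
      apply hx
      simpa using h1.symm
    · exact hv h
open scoped ContinuousMap

def DecSet : Set (Matrix (Fin 6) (Fin 6) ℂ) :=
  {A | A ≠ 0 ∧ ∃ u v : Fin 6 → ℂ, ∀ k l, A k l = u k * v l - u l * v k}

theorem dec_mem {A : Matrix (Fin 6) (Fin 6) ℂ} {i l : Fin 6} (h : A i l ≠ 0) (u v : Fin 6 → ℂ)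
    (huv : ∀ k l, A k l = u k * v l - u l * v k) : A ∈ DecSet :=
  ⟨fun h0 ↦ h (by rw [h0]; rfl), u, v, huv⟩

theorem exists_entry {A : Matrix (Fin 6) (Fin 6) ℂ} (h : A ≠ 0) : ∃ i j, A i j ≠ 0 := by
  by_contra! h'
  exact h (by ext i j; exact h' i j)

theorem dec_eq : {A : Matrix (Fin 6) (Fin 6) ℂ | Aᵀ = -A ∧ A.rank = 2} = DecSet := by
  ext A
  constructor
  · rintro ⟨hs, hr⟩
    have hs' : ∀ k l, A l k = - A k l := fun k l ↦ congrFun (congrFun hs k) l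
    have h0 : A ≠ 0 := by rintro rfl; simp at hr
    obtain ⟨i, j, hij⟩ := exists_entry h0
    have hd : ∀ k, A k k = 0 := fun k ↦ by
      have := hs' k k
      linear_combination (1/2) * this
    refine ⟨h0, fun k ↦ A i k / A i j, fun k ↦ A j k, ?_⟩
    rw [Matrix.rank_eq_finrank_span_cols] at hr
    have hli : LinearIndependent ℂ ![A.col i, A.col j] := by
      rw [LinearIndependent.pair_iff]
      intro s t hst
      have h1 := congrFun hst i
      have h2 := congrFun hst j
      simp [hd, hij] at h1 h2
      rw [hs' i j] at h2
      simp [hij] at h2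
      exact ⟨h2, h1⟩
    have hsp : Submodule.span ℂ (Set.range ![A.col i, A.col j]) =
        Submodule.span ℂ (Set.range A.col) := by
      apply Submodule.eq_of_le_of_finrank_eq
      · apply Submodule.span_mono
        rintro _ ⟨k, rfl⟩
        fin_cases k
        exacts [⟨i, rfl⟩, ⟨j, rfl⟩]
      · rw [hr, finrank_span_eq_card hli]; simp
    intro p k
    have hk : A.col k ∈ Submodule.span ℂ (Set.range ![A.col i, A.col j]) := by
      rw [hsp]; exact Submodule.subset_span ⟨k, rfl⟩
    rw [Matrix.range_cons, Matrix.range_cons, Matrix.range_empty, Set.union_empty,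
      Set.singleton_union, Submodule.mem_span_pair] at hk
    obtain ⟨a, b, hab⟩ := hk
    have e : ∀ q, a * A q i + b * A q j = A q k := fun q ↦ congrFun hab q
    have e1 := e i
    have e2 := e j
    have e3 := e p
    rw [hd] at e1 e2
    rw [hs' i j] at e2
    rw [hs' i p, hs' j p] at e3
    field_simp
    linear_combination (-A i j) * e3 - (A j p) * e1 + A i p * e2
  · rintro ⟨h0, u, v, huv⟩
    refine ⟨by ext k l; simp [huv, mul_comm], ?_⟩
    obtain ⟨i, j, hij⟩ := exists_entry h0
    apply le_antisymm
    · have hA : A = (Matrix.of ![u, v])ᵀ * (Matrix.of ![v, -u]) := by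
        ext k l
        simp [huv, Matrix.mul_apply, Fin.sum_univ_two]
        ring
      rw [hA]
      refine (Matrix.rank_mul_le_right _ _).trans ?_
      simpa using Matrix.rank_le_card_height (Matrix.of ![v, -u])
    · have h1 := Matrix.rank_submatrix_le A ![i, j] ![i, j]
      have h2 : (A.submatrix ![i, j] ![i, j]).rank = 2 := by
        rw [Matrix.rank_of_isUnit]
        · simp
        · rw [Matrix.isUnit_iff_isUnit_det, Matrix.det_fin_two, isUnit_iff_ne_zero]
          have e1 : A i i = 0 := by rw [huv]; ring
          have e2 : A j i = - A i j := by rw [huv, huv]; ring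
          simp [e1, e2, hij]
      omega

theorem dec_rep {A : Matrix (Fin 6) (Fin 6) ℂ} (hA : A ∈ DecSet) {i : Fin 6}
    (h : ∃ l, A i l ≠ 0) : ∃ u v : Fin 6 → ℂ, u i ≠ 0 ∧ ∀ k l, A k l = u k * v l - u l * v k := by
  obtain ⟨-, u, v, huv⟩ := hA
  obtain ⟨l, hl⟩ := h
  by_cases hu : u i = 0
  · refine ⟨v, -u, ?_, ?_⟩
    · intro hv
      apply hl
      rw [huv, hu, hv]; ring
    · intro k l
      rw [huv]; simp; ring
  · exact ⟨u, v, hu, huv⟩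

/-- row `i` nonzero -/
def RowSet (i : Fin 6) : Set (Matrix (Fin 6) (Fin 6) ℂ) := {A | ∃ l, A i l ≠ 0}

theorem rowSet_open (i : Fin 6) : IsOpen (RowSet i) := by
  have : RowSet i = ⋃ l, {A : Matrix (Fin 6) (Fin 6) ℂ | A i l ≠ 0} := by
    ext A; simp [RowSet]
  rw [this]
  refine isOpen_iUnion fun l ↦ ?_
  exact isOpen_ne_fun (continuous_id.matrix_elem i l) continuous_const

/-- keep row and column `i`, scale the rest -/
def scl (i : Fin 6) (t : ℂ) (A : Matrix (Fin 6) (Fin 6) ℂ) : Matrix (Fin 6) (Fin 6) ℂ :=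
  Matrix.of fun k l ↦ if k = i ∨ l = i then A k l else t * A k l

theorem scl_mem {i : Fin 6} (t : ℂ) {A : Matrix (Fin 6) (Fin 6) ℂ}
    (hA : A ∈ DecSet ∩ RowSet i) : scl i t A ∈ DecSet ∩ RowSet i := by
  obtain ⟨u, v, hu, huv⟩ := dec_rep hA.1 hA.2
  obtain ⟨l, hl⟩ := hA.2
  have hl' : scl i t A i l ≠ 0 := by simpa [scl] using hl
  refine ⟨dec_mem hl' (fun k ↦ if k = i then u i else t * u k)
    (fun k ↦ if k = i then 0 else v k - v i / u i * u k) ?_, l, hl'⟩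
  intro k l
  simp only [scl, Matrix.of_apply, huv]
  by_cases hk : k = i <;> by_cases hl : l = i <;> simp [hk, hl] <;> field_simp <;> ring

/-- the matrix with given row `i` -/
def rowMat (i : Fin 6) (a : {j : Fin 6 // j ≠ i} → ℂ) : Matrix (Fin 6) (Fin 6) ℂ :=
  Matrix.of fun k l ↦ if h : l = i then (if h' : k = i then 0 else - a ⟨k, h'⟩)
    else (if k = i then a ⟨l, h⟩ else 0)

theorem rowMat_mem (i : Fin 6) (a : {j : Fin 6 // j ≠ i} → ℂ) (ha : a ≠ 0) :
    rowMat i a ∈ DecSet ∩ RowSet i := by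
  obtain ⟨⟨l, hl⟩, h⟩ := Function.ne_iff.1 ha
  have hl' : rowMat i a i l ≠ 0 := by simpa [rowMat, hl] using h
  refine ⟨dec_mem hl' (fun k ↦ if k = i then 1 else 0)
    (fun k ↦ if h : k = i then 0 else a ⟨k, h⟩) ?_, l, hl'⟩
  intro k l
  by_cases hk : k = i <;> by_cases hl : l = i <;> simp [rowMat, hk, hl]

theorem row_ne {A : Matrix (Fin 6) (Fin 6) ℂ} {i : Fin 6} (hA : A ∈ DecSet ∩ RowSet i) :
    (fun j : {j : Fin 6 // j ≠ i} ↦ A i j) ∈ ({0}ᶜ : Set ({j : Fin 6 // j ≠ i} → ℂ)) := by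
  obtain ⟨⟨-, u, v, huv⟩, l, hl⟩ := hA
  intro h
  apply hl
  by_cases hli : l = i
  · rw [hli, huv]; ring
  · exact congrFun h ⟨l, hli⟩

theorem row_simply (i : Fin 6) : IsSimplyConnected (DecSet ∩ RowSet i) := by
  have hE : IsSimplyConnected ({0}ᶜ : Set ({j : Fin 6 // j ≠ i} → ℂ)) := by
    apply punct_simply
    rw [Module.finrank_pi_fintype]
    simp [Complex.finrank_real_complex]
  have : SimplyConnectedSpace ({0}ᶜ : Set ({j : Fin 6 // j ≠ i} → ℂ)) := hE
  let f : C((DecSet ∩ RowSet i : Set _), ({0}ᶜ : Set ({j : Fin 6 // j ≠ i} → ℂ))) :=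
    ⟨fun A ↦ ⟨fun j ↦ A.1 i j, row_ne A.2⟩, by
      refine Continuous.subtype_mk (continuous_pi fun j ↦ ?_) _
      exact (Continuous.matrix_elem (A := fun A : (DecSet ∩ RowSet i : Set _) ↦ A.1)
        continuous_subtype_val i j)⟩
  let g : C(({0}ᶜ : Set ({j : Fin 6 // j ≠ i} → ℂ)), (DecSet ∩ RowSet i : Set _)) :=
    ⟨fun a ↦ ⟨rowMat i a.1, rowMat_mem i a.1 a.2⟩, by
      refine Continuous.subtype_mk (continuous_matrix fun k l ↦ ?_) _
      have hc : ∀ m, Continuous fun a : ({0}ᶜ : Set ({j : Fin 6 // j ≠ i} → ℂ)) ↦ a.1 m :=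
        fun m ↦ (continuous_apply m).comp continuous_subtype_val
      by_cases hk : k = i <;> by_cases hl : l = i <;> simp only [rowMat, hk, hl, Matrix.of_apply,
        dif_pos, dif_neg, if_true, if_false, not_false_eq_true]
      · exact continuous_const
      · exact hc _
      · exact (hc _).neg
      · exact continuous_const⟩
  have e : (DecSet ∩ RowSet i : Set _) ≃ₕ ({0}ᶜ : Set ({j : Fin 6 // j ≠ i} → ℂ)) :=
    { toFun := f
      invFun := g
      left_inv := by
        refine ⟨⟨⟨fun x ↦ ⟨scl i (x.1 : ℝ) x.2.1, scl_mem _ x.2.2⟩, ?_⟩, ?_, ?_⟩⟩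
        · refine Continuous.subtype_mk (continuous_matrix fun k l ↦ ?_) _
          have h1 : Continuous fun x : unitInterval × (DecSet ∩ RowSet i : Set _) ↦ x.2.1 k l :=
            (continuous_subtype_val.comp continuous_snd).matrix_elem k l
          by_cases hk : k = i ∨ l = i
          · simpa [scl, hk] using h1
          · simp only [scl, hk, Matrix.of_apply, if_false]
            exact Continuous.mul (by fun_prop) h1
        · rintro ⟨A, hA⟩
          obtain ⟨u, v, huv⟩ := hA.1.2
          apply Subtype.ext
          ext k l
          by_cases hk : k = i <;> by_cases hl : l = i <;>
            simp [f, g, scl, rowMat, hk, hl, huv]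
        · rintro ⟨A, hA⟩
          apply Subtype.ext
          ext k l
          simp [scl]
      right_inv := by
        have : f.comp g = ContinuousMap.id _ := by
          ext a j
          simp [f, g, rowMat, j.2]
        rw [this] }
  exact e.simplyConnectedSpace

theorem two_joined {i j : Fin 6} (hij : i ≠ j) {A : Matrix (Fin 6) (Fin 6) ℂ}
    (hA : A ∈ DecSet ∩ (RowSet i ∩ RowSet j)) :
    ∃ B, B i j ≠ 0 ∧ B ∈ DecSet ∧ JoinedIn (DecSet ∩ (RowSet i ∩ RowSet j)) A B := by
  by_cases h : A i j = 0
  swap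
  · exact ⟨A, h, hA.1, JoinedIn.refl hA⟩
  obtain ⟨⟨h0, u, v, huv⟩, ⟨k, hk⟩, hj⟩ := hA
  have hkj : k ≠ j := by rintro rfl; exact hk h
  let F : ℝ → Matrix (Fin 6) (Fin 6) ℂ := fun s ↦ Matrix.of fun p q ↦
    (u p + if p = j then s * u k else 0) * (v q + if q = j then s * v k else 0) -
    (u q + if q = j then s * u k else 0) * (v p + if p = j then s * v k else 0)
  have hF0 : F 0 = A := by ext p q; simp [F, huv]
  have hFij : ∀ s, F s i j = s * A i k := by
    intro s
    rw [huv] at h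
    simp only [F, Matrix.of_apply, hij, if_false, if_true, huv]
    linear_combination h
  have hmem : ∀ s, F s ∈ DecSet ∩ (RowSet i ∩ RowSet j) := by
    intro s
    by_cases hs : s = 0
    · rw [hs, hF0]; exact ⟨⟨h0, u, v, huv⟩, ⟨k, hk⟩, hj⟩
    · have h1 : F s i j ≠ 0 := by
        rw [hFij]; exact mul_ne_zero (by exact_mod_cast hs) hk
      refine ⟨dec_mem h1 _ _ (fun p q ↦ rfl), ⟨j, h1⟩, i, ?_⟩
      have : F s j i = - F s i j := by simp only [F, Matrix.of_apply]; ring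
      rw [this]; exact neg_ne_zero.2 h1
  refine ⟨F 1, ?_, (hmem 1).1, JoinedIn.ofLine (f := F) ?_ hF0 rfl ?_⟩
  · rw [hFij]; simpa using hk
  · apply Continuous.continuousOn
    refine continuous_matrix fun p q ↦ ?_
    simp only [F, Matrix.of_apply]
    split_ifs <;> fun_prop
  · rintro _ ⟨s, -, rfl⟩; exact hmem s

/-- The matrix of `c e_i ∧ e_j`. -/
def elem (i j : Fin 6) (c : ℂ) : Matrix (Fin 6) (Fin 6) ℂ := Matrix.of fun p q ↦
  (if p = i then c else 0) * (if q = j then 1 else 0) -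
  (if q = i then c else 0) * (if p = j then 1 else 0)

theorem dec_mem_two {i j : Fin 6} {B : Matrix (Fin 6) (Fin 6) ℂ} (hB : B i j ≠ 0) (u v : Fin 6 → ℂ)
    (huv : ∀ k l, B k l = u k * v l - u l * v k) : B ∈ DecSet ∩ (RowSet i ∩ RowSet j) := by
  refine ⟨dec_mem hB u v huv, ⟨j, hB⟩, i, ?_⟩
  have : B j i = - B i j := by rw [huv, huv]; ring
  rw [this]; exact neg_ne_zero.2 hB

theorem two_joined' {i j : Fin 6} (hij : i ≠ j) {B : Matrix (Fin 6) (Fin 6) ℂ}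
    (hB : B ∈ DecSet) (h : B i j ≠ 0) :
    JoinedIn (DecSet ∩ (RowSet i ∩ RowSet j)) B (elem i j (B i j)) := by
  obtain ⟨-, u, v, huv⟩ := hB
  let d : ℝ → Fin 6 → ℂ := fun s p ↦ if p = i ∨ p = j then 1 else 1 - s
  let F : ℝ → Matrix (Fin 6) (Fin 6) ℂ := fun s ↦ Matrix.of fun p q ↦ d s p * d s q * B p q
  refine JoinedIn.ofLine (f := F) ?_ ?_ ?_ ?_
  · apply Continuous.continuousOn
    refine continuous_matrix fun p q ↦ ?_
    simp only [F, d, Matrix.of_apply]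
    split_ifs <;> fun_prop
  · ext p q; simp [F, d]
  · ext p q
    have e1 : ∀ p, B p p = 0 := fun p ↦ by rw [huv]; ring
    have e2 : B j i = - B i j := by rw [huv, huv]; ring
    have hji := hij.symm
    simp only [F, d, elem, Matrix.of_apply]
    by_cases hpi : p = i
    · subst hpi
      by_cases hqi : q = p
      · subst hqi; simp [e1, hij]
      · by_cases hqj : q = j
        · subst hqj; simp [hij, hji]
        · simp [hqi, hqj, hij]
    · by_cases hpj : p = j
      · subst hpj
        by_cases hqi : q = i
        · subst hqi; simp [e2, hij, hji]
        · by_cases hqj : q = p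
          · subst hqj; simp [hji, e1]
          · simp [hqi, hqj, hji]
      · simp [hpi, hpj]
  · rintro _ ⟨s, -, rfl⟩
    refine dec_mem_two ?_ (fun p ↦ d s p * u p) (fun p ↦ d s p * v p) ?_
    · simpa [F, d] using h
    · intro k l
      simp only [F, Matrix.of_apply, huv]; ring

theorem elem_joined {i j : Fin 6} (hij : i ≠ j) {c : ℂ} (hc : c ≠ 0) :
    JoinedIn (DecSet ∩ (RowSet i ∩ RowSet j)) (elem i j c) (elem i j 1) := by
  have h : IsPathConnected ({0}ᶜ : Set ℂ) :=
    isPathConnected_compl_singleton_of_one_lt_rank (by simp [Complex.rank_real_complex]) 0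
  have hcont : Continuous (elem i j) := by
    refine continuous_matrix fun p q ↦ ?_
    simp only [elem, Matrix.of_apply]
    split_ifs <;> fun_prop
  have h2 := h.image hcont
  refine (h2.joinedIn _ ⟨c, hc, rfl⟩ _ ⟨1, by simp, rfl⟩).mono ?_
  rintro _ ⟨b, hb, rfl⟩
  refine dec_mem_two ?_ _ _ (fun k l ↦ rfl)
  simpa [elem, hij, hij.symm] using hb

theorem two_pc (i j : Fin 6) : IsPathConnected (DecSet ∩ (RowSet i ∩ RowSet j)) := by
  by_cases hij : i = j
  · subst hij
    rw [Set.inter_self]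
    exact (row_simply i).isPathConnected
  · refine ⟨elem i j 1, ?_, ?_⟩
    · refine dec_mem_two ?_ _ _ (fun k l ↦ rfl)
      simp [elem, hij, Ne.symm hij]
    · intro A hA
      obtain ⟨B, h1, h2, h3⟩ := two_joined hij hA
      exact ((h3.trans (two_joined' hij h2 h1)).trans (elem_joined hij h1)).symm

/-- The punctured affine cone over the Grassmannian `Gr(2,6)` in its Plücker embedding,
namely the space of skew-symmetric `6 × 6` complex matrices of rank exactly `2`
(equivalently, the nonzero skew-symmetric matrices of rank at most `2`), is simply
connected. -/
theorem skew_rank_two_simply_connected :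
    SimplyConnectedSpace
      {A : Matrix (Fin 6) (Fin 6) ℂ | Aᵀ = -A ∧ A.rank = 2} := by
  rw [dec_eq]
  let x0 : Matrix (Fin 6) (Fin 6) ℂ := Matrix.of fun p q ↦
    (1 : ℂ) * ((q : ℕ) : ℂ) - 1 * ((p : ℕ) : ℂ)
  have hx : ∀ p q : Fin 6, p ≠ q → x0 p q ≠ 0 := by
    intro p q hpq h
    simp only [x0, Matrix.of_apply, one_mul, sub_eq_zero] at h
    have : (q : ℕ) = p := by exact_mod_cast h
    exact hpq (Fin.ext this.symm)
  refine vk_set DecSet RowSet rowSet_open row_simply x0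
    (dec_mem (hx 0 1 (by decide)) (fun _ ↦ 1) (fun p ↦ ((p : ℕ) : ℂ)) (fun _ _ ↦ rfl)) ?_ two_pc ?_
  · intro i
    obtain ⟨l, hl⟩ := exists_ne i
    exact ⟨l, hx i l hl.symm⟩
  · intro A hA
    obtain ⟨i, j, h⟩ := exists_entry hA.1
    exact ⟨i, j, h⟩
end
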